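/- arXiv:math/0503397 — 2 statements merged into one kernel-verified Lean document; each statement's English description precedes it below -/
import Mathlib

section
/- Let n ≥ 1, let 0 ≤ s ≤ n, let f : ℝⁿ → ℂ be C^∞, and let A_1, …, A_s be convex bodies in ℝⁿ. Define φ(K) := ∂^s/∂λ_1⋯∂λ_s |_{λ=0} ∫_{K + λ_1 A_1 + ⋯ + λ_s A_s} f(y) dy (the mixed one-sided partial derivative at λ = 0). Then φ is a continuous valuation on 𝒦(ℝⁿ): (a) φ(K ∪ K') + φ(K ∩ K') = φ(K) + φ(K') whenever K, K' and K ∪ K' are convex bodies, and (b) φ is continuous with respect to the Hausdorff metric on 𝒦(ℝⁿ). -/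
open scoped Pointwise ContDiff
open MeasureTheory Set Filter

noncomputable section

/-- Euclidean space `ℝⁿ`. -/
abbrev Euc (n : ℕ) := EuclideanSpace ℝ (Fin n)

/-- The one-point convex body `{x}`. -/
def ptBody {n : ℕ} (x : Euc n) : ConvexBody (Euc n) :=
  ⟨{x}, convex_singleton x, isCompact_singleton, Set.singleton_nonempty x⟩

/-- The convex body `t • K + x`. -/
def scaleTrans {n : ℕ} (t : ℝ) (x : Euc n) (K : ConvexBody (Euc n)) : ConvexBody (Euc n) :=
  t • K + ptBody x

/-- One-sided partial derivative in the `i`-th coordinate: the derivative of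
`t ↦ g(λ with i-th coordinate replaced by t)` within `[0, ∞)` (so one-sided at `0`). -/
def pderivOrth {s : ℕ} {F : Type*} [NormedAddCommGroup F] [NormedSpace ℝ F]
    (g : (Fin s → ℝ) → F) (i : Fin s) : (Fin s → ℝ) → F :=
  fun lam => derivWithin (fun t => g (Function.update lam i t)) (Set.Ici 0) (lam i)

/-- The iterated one-sided mixed partial derivative `∂^s/∂λ₁⋯∂λ_s |_{λ=0}` of a function on
the closed orthant `ℝ_{≥0}^s`. -/
def mixedPartialAtZero {s : ℕ} {F : Type*} [NormedAddCommGroup F] [NormedSpace ℝ F]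
    (g : (Fin s → ℝ) → F) : F :=
  (List.foldl pderivOrth g (List.finRange s)) 0

/-- `φ` is a valuation: whenever `M = K ∪ L` and `N = K ∩ L` are convex bodies,
`φ M + φ N = φ K + φ L`. -/
def IsValuation {n : ℕ} (φ : ConvexBody (Euc n) → ℂ) : Prop :=
  ∀ K L M N : ConvexBody (Euc n),
    (M : Set (Euc n)) = (K : Set (Euc n)) ∪ (L : Set (Euc n)) →
    (N : Set (Euc n)) = (K : Set (Euc n)) ∩ (L : Set (Euc n)) →
    φ M + φ N = φ K + φ L

open scoped Topology

section TaylorBound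

variable {s : ℕ}

/-- The half-open unit cube `[0, 1)^s`. -/
def unitCube (s : ℕ) : Set (Fin s → ℝ) := Set.pi univ fun _ => Ico 0 1

/-- All iterated one-sided derivatives of `F` along the list `l` satisfy a first-order Taylor
estimate with quadratic error constant `C` on the unit cube. -/
def TaylorBound (C : ℝ) : List (Fin s) → ((Fin s → ℝ) → ℂ) → Prop
  | [], _ => True
  | i :: l, F => (∀ lam ∈ unitCube s, ∀ t ∈ Ico (0 : ℝ) 1,
      ‖F (Function.update lam i t) - F lam - (t - lam i) • pderivOrth F i lam‖
        ≤ C * (t - lam i) ^ 2) ∧ TaylorBound C l (pderivOrth F i)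

theorem update_mem_unitCube {lam : Fin s → ℝ} (hl : lam ∈ unitCube s) (i : Fin s) {t : ℝ}
    (ht : t ∈ Ico (0 : ℝ) 1) : Function.update lam i t ∈ unitCube s := by
  intro j _
  by_cases h : j = i
  · subst h; simpa using ht
  · simpa [h] using hl j (mem_univ _)

theorem Ico_mem_nhdsWithin_Ici {a : ℝ} (ha : a ∈ Ico (0 : ℝ) 1) :
    Ico (0 : ℝ) 1 ∈ 𝓝[Ici 0] a := by
  rw [← Ici_inter_Iio]
  exact inter_mem self_mem_nhdsWithin (mem_nhdsWithin_of_mem_nhds (Iio_mem_nhds ha.2))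

theorem pderivOrth_eq_of_taylor {F : (Fin s → ℝ) → ℂ} {i : Fin s} {lam : Fin s → ℝ}
    (hl : lam ∈ unitCube s) {C : ℝ} {d : ℂ}
    (h : ∀ t ∈ Ico (0 : ℝ) 1,
      ‖F (Function.update lam i t) - F lam - (t - lam i) • d‖ ≤ C * (t - lam i) ^ 2) :
    pderivOrth F i lam = d := by
  have hli := hl i (mem_univ _)
  have key : HasDerivWithinAt (fun t => F (Function.update lam i t)) d (Ici 0) (lam i) := by
    rw [hasDerivWithinAt_iff_isLittleO]
    have hO : (fun t => F (Function.update lam i t) - F (Function.update lam i (lam i))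
        - (t - lam i) • d) =O[𝓝[Ici 0] (lam i)] fun t => (t - lam i) ^ 2 := by
      refine Asymptotics.IsBigO.of_bound C ?_
      filter_upwards [Ico_mem_nhdsWithin_Ici hli] with t ht
      simpa [abs_of_nonneg (sq_nonneg (t - lam i))] using h t ht
    refine hO.trans_isLittleO ?_
    have : (fun t : ℝ => (t - lam i) ^ 2) =o[𝓝 (lam i)] fun t => t - lam i := by
      have h1 : Tendsto (fun t : ℝ => t - lam i) (𝓝 (lam i)) (𝓝 0) :=
        tendsto_sub_nhds_zero_iff.2 tendsto_id
      have := (Asymptotics.isLittleO_pow_id (𝕜 := ℝ) (n := 2) (by norm_num)).comp_tendsto h1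
      simpa [Function.comp_def] using this
    exact this.mono nhdsWithin_le_nhds
  exact key.derivWithin ((uniqueDiffOn_Ici 0) _ hli.1)

theorem pderivOrth_congr {F G : (Fin s → ℝ) → ℂ} (h : EqOn F G (unitCube s)) (i : Fin s) :
    EqOn (pderivOrth F i) (pderivOrth G i) (unitCube s) := by
  intro lam hl
  have hli := hl i (mem_univ _)
  refine Filter.EventuallyEq.derivWithin_eq ?_ ?_
  · filter_upwards [Ico_mem_nhdsWithin_Ici hli] with t ht
    exact h (update_mem_unitCube hl i ht)
  · exact h (update_mem_unitCube hl i hli)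

theorem foldl_pderivOrth_congr (l : List (Fin s)) {F G : (Fin s → ℝ) → ℂ}
    (h : EqOn F G (unitCube s)) :
    EqOn (l.foldl pderivOrth F) (l.foldl pderivOrth G) (unitCube s) := by
  induction l generalizing F G with
  | nil => exact h
  | cons i l ih => exact ih (pderivOrth_congr h i)

theorem TaylorBound.congr {C : ℝ} {l : List (Fin s)} {F G : (Fin s → ℝ) → ℂ}
    (hF : TaylorBound C l F) (h : EqOn F G (unitCube s)) : TaylorBound C l G := by
  induction l generalizing F G with
  | nil => trivial
  | cons i l ih =>
    refine ⟨fun lam hl t ht => ?_, ih hF.2 (pderivOrth_congr h i)⟩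
    rw [← h hl, ← h (update_mem_unitCube hl i ht), ← pderivOrth_congr h i hl]
    exact hF.1 lam hl t ht

theorem TaylorBound.of_step {C : ℝ} {i : Fin s} {l : List (Fin s)} {F F' : (Fin s → ℝ) → ℂ}
    (h : ∀ lam ∈ unitCube s, ∀ t ∈ Ico (0 : ℝ) 1,
      ‖F (Function.update lam i t) - F lam - (t - lam i) • F' lam‖ ≤ C * (t - lam i) ^ 2)
    (h' : TaylorBound C l F') :
    TaylorBound C (i :: l) F ∧ EqOn F' (pderivOrth F i) (unitCube s) := by
  have he : EqOn F' (pderivOrth F i) (unitCube s) := fun lam hl =>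
    (pderivOrth_eq_of_taylor hl (h lam hl)).symm
  refine ⟨⟨fun lam hl t ht => ?_, h'.congr he⟩, he⟩
  rw [← he hl]
  exact h lam hl t ht

theorem TaylorBound.mono {C C' : ℝ} (hC : C ≤ C') {l : List (Fin s)} {F : (Fin s → ℝ) → ℂ}
    (hF : TaylorBound C l F) : TaylorBound C' l F := by
  induction l generalizing F with
  | nil => trivial
  | cons i l ih =>
    exact ⟨fun lam hl t ht => (hF.1 lam hl t ht).trans
      (mul_le_mul_of_nonneg_right hC (sq_nonneg _)), ih hF.2⟩

theorem TaylorBound.add {C C' : ℝ} {l : List (Fin s)} {F G : (Fin s → ℝ) → ℂ}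
    (hF : TaylorBound C l F) (hG : TaylorBound C' l G) :
    TaylorBound (C + C') l (F + G) ∧
      EqOn (l.foldl pderivOrth (F + G)) (l.foldl pderivOrth F + l.foldl pderivOrth G)
        (unitCube s) := by
  induction l generalizing F G with
  | nil => exact ⟨trivial, fun _ _ => rfl⟩
  | cons i l ih =>
    obtain ⟨h1, h2⟩ := ih hF.2 hG.2
    have := TaylorBound.of_step (i := i) (F := F + G) (C := C + C') (fun lam hl t ht => ?_) h1
    · exact ⟨this.1, (foldl_pderivOrth_congr l this.2.symm).trans h2⟩
    · have a := hF.1 lam hl t ht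
      have b := hG.1 lam hl t ht
      rw [add_mul]
      refine le_trans (le_of_eq ?_) ((norm_add_le _ _).trans (add_le_add a b))
      congr 1
      simp only [Pi.add_apply, smul_add]
      ring

theorem TaylorBound.sum {ι : Type*} (T : Finset ι) {C : ι → ℝ} {l : List (Fin s)}
    {F : ι → (Fin s → ℝ) → ℂ} (hF : ∀ k ∈ T, TaylorBound (C k) l (F k)) :
    TaylorBound (∑ k ∈ T, C k) l (∑ k ∈ T, F k) := by
  classical
  induction T using Finset.induction_on with
  | empty =>
    simp only [Finset.sum_empty]
    clear hF
    induction l with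
    | nil => trivial
    | cons i l ih => exact (TaylorBound.of_step (F' := 0) (by simp) ih).1
  | insert k T hk ih =>
    rw [Finset.sum_insert hk, Finset.sum_insert hk]
    exact ((hF k (Finset.mem_insert_self _ _)).add
      (ih fun j hj => hF j (Finset.mem_insert_of_mem hj))).1

theorem TaylorBound.smul (a : ℝ) {C : ℝ} {l : List (Fin s)} {F : (Fin s → ℝ) → ℂ}
    (hF : TaylorBound C l F) : TaylorBound (|a| * C) l (a • F) := by
  induction l generalizing F with
  | nil => trivial
  | cons i l ih =>
    refine (TaylorBound.of_step (F' := a • pderivOrth F i) (fun lam hl t ht => ?_) (ih hF.2)).1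
    have := mul_le_mul_of_nonneg_left (hF.1 lam hl t ht) (abs_nonneg a)
    rw [← Real.norm_eq_abs, ← norm_smul, ← mul_assoc] at this
    refine le_trans (le_of_eq ?_) this
    congr 1
    simp only [Pi.smul_apply, smul_sub, smul_comm a]

theorem cauchy_of_taylor {ι : Type*} {L : Filter ι} [NeBot L] {C a : ℝ} (ha : a ∈ Ico (0 : ℝ) 1)
    {g : ι → ℝ → ℂ} {g₀ : ℝ → ℂ} {d : ι → ℂ}
    (hg : ∀ t ∈ Ico (0 : ℝ) 1, Tendsto (fun j => g j t) L (𝓝 (g₀ t)))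
    (h : ∀ᶠ j in L, ∀ t ∈ Ico (0 : ℝ) 1,
      ‖g j t - g j a - (t - a) • d j‖ ≤ C * (t - a) ^ 2) :
    Cauchy (map d L) := by
  rw [Metric.cauchy_iff]
  refine ⟨inferInstance, fun ε hε => ?_⟩
  set r := min ((1 - a) / 2) (ε / (4 * (|C| + 1))) with hr
  have hr0 : 0 < r := lt_min (by linarith [ha.2]) (by positivity)
  have hr1 : r ≤ (1 - a) / 2 := min_le_left _ _
  have hr2 : |C| * r < ε / 4 := by
    have : r ≤ ε / (4 * (|C| + 1)) := min_le_right _ _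
    rw [le_div_iff₀ (by positivity)] at this
    nlinarith
  have ht : a + r ∈ Ico (0 : ℝ) 1 := ⟨by linarith [ha.1], by linarith [ha.2]⟩
  set q := r⁻¹ • (g₀ (a + r) - g₀ a) with hq
  have hlim : Tendsto (fun j => r⁻¹ • (g j (a + r) - g j a)) L (𝓝 q) :=
    ((hg _ ht).sub (hg _ ha)).const_smul _
  refine ⟨_, image_mem_map (inter_mem h
    (hlim (Metric.ball_mem_nhds q (show 0 < ε / 4 by linarith)))), ?_⟩
  have key : ∀ j, (∀ t ∈ Ico (0 : ℝ) 1, ‖g j t - g j a - (t - a) • d j‖ ≤ C * (t - a) ^ 2) →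
      r⁻¹ • (g j (a + r) - g j a) ∈ Metric.ball q (ε / 4) → dist (d j) q < ε / 2 := by
    intro j h1 h2
    have h3 := h1 _ ht
    rw [add_sub_cancel_left] at h3
    have h4 : ‖r⁻¹ • (g j (a + r) - g j a) - d j‖ ≤ |C| * r := by
      have : r⁻¹ • (g j (a + r) - g j a) - d j
          = r⁻¹ • (g j (a + r) - g j a - r • d j) := by
        rw [smul_sub r⁻¹ (_ - _), smul_smul, inv_mul_cancel₀ hr0.ne', one_smul]
      rw [this, norm_smul, norm_inv, Real.norm_of_nonneg hr0.le, inv_mul_le_iff₀ hr0]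
      refine h3.trans ?_
      have := mul_le_mul_of_nonneg_right (le_abs_self C) (sq_nonneg r)
      linarith
    have h5 := mem_ball_iff_norm.1 h2
    rw [dist_eq_norm]
    calc ‖d j - q‖ = ‖(r⁻¹ • (g j (a + r) - g j a) - q)
          - (r⁻¹ • (g j (a + r) - g j a) - d j)‖ := by congr 1; abel
      _ ≤ _ := norm_sub_le _ _
      _ < _ := by linarith
  rintro _ ⟨j, ⟨hj1, hj2⟩, rfl⟩ _ ⟨k, ⟨hk1, hk2⟩, rfl⟩
  calc dist (d j) (d k) ≤ dist (d j) q + dist (d k) q := dist_triangle_right _ _ _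
    _ < ε := by linarith [key j hj1 hj2, key k hk1 hk2]

theorem TaylorBound.tendsto {ι : Type*} {L : Filter ι} [NeBot L] {C : ℝ} {l : List (Fin s)}
    {F : ι → (Fin s → ℝ) → ℂ} {F₀ : (Fin s → ℝ) → ℂ}
    (hF : ∀ᶠ j in L, TaylorBound C l (F j))
    (h : ∀ lam ∈ unitCube s, Tendsto (fun j => F j lam) L (𝓝 (F₀ lam))) :
    TaylorBound C l F₀ ∧ ∀ lam ∈ unitCube s,
      Tendsto (fun j => l.foldl pderivOrth (F j) lam) L (𝓝 (l.foldl pderivOrth F₀ lam)) := by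
  induction l generalizing F F₀ with
  | nil => exact ⟨trivial, h⟩
  | cons i l ih =>
    have hc : ∀ lam ∈ unitCube s, ∃ d, Tendsto (fun j => pderivOrth (F j) i lam) L (𝓝 d) := by
      intro lam hl
      have := cauchy_of_taylor (L := L) (C := C) (hl i (mem_univ _))
        (g := fun j t => F j (Function.update lam i t))
        (g₀ := fun t => F₀ (Function.update lam i t)) (d := fun j => pderivOrth (F j) i lam)
        (fun t ht => h _ (update_mem_unitCube hl i ht))
        (by
          filter_upwards [hF] with j hj t ht
          simpa using hj.1 lam hl t ht)
      exact cauchy_map_iff_exists_tendsto.1 this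
    choose! D hD using hc
    obtain ⟨h1, h2⟩ := ih (hF.mono fun j hj => hj.2) hD
    have := TaylorBound.of_step (i := i) (F := F₀) (C := C) (fun lam hl t ht => ?_) h1
    · refine ⟨this.1, fun lam hl => ?_⟩
      simp only [List.foldl_cons]
      rw [← foldl_pderivOrth_congr l this.2 hl]
      exact h2 lam hl
    · refine le_of_tendsto ((((h _ (update_mem_unitCube hl i ht)).sub (h lam hl)).sub
        ((hD lam hl).const_smul _)).norm) ?_
      filter_upwards [hF] with j hj using hj.1 lam hl t ht

theorem TaylorBound.integral {X : Type*} [MeasurableSpace X] {μ : Measure X} {b : X → ℝ}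
    (hb : Integrable b μ) {l : List (Fin s)} {k : X → (Fin s → ℝ) → ℂ}
    (hk : ∀ x, TaylorBound (b x) l (k x))
    (hi : ∀ lam ∈ unitCube s, Integrable (fun x => k x lam) μ) :
    TaylorBound (∫ x, b x ∂μ) l (fun lam => ∫ x, k x lam ∂μ) := by
  induction l generalizing k with
  | nil => trivial
  | cons i l ih =>
    have hint : ∀ lam ∈ unitCube s, Integrable (fun x => pderivOrth (k x) i lam) μ := by
      intro lam hl
      have hli := hl i (mem_univ _)
      set r : ℕ → ℝ := fun m => (1 - lam i) * (1 / ((m : ℝ) + 1 + 1)) with hr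
      have hpos : 0 < 1 - lam i := by linarith [hli.2]
      have hr0 : ∀ m, 0 < r m := fun m => by positivity
      have hr1 : ∀ m, r m < 1 - lam i := fun m => by
        have : 1 / ((m : ℝ) + 1 + 1) < 1 := by
          rw [div_lt_one (by positivity)]
          have : (0 : ℝ) ≤ m := m.cast_nonneg
          linarith
        have := mul_lt_mul_of_pos_left this hpos
        rwa [mul_one] at this
      have hrl : Tendsto r atTop (𝓝 0) := by
        have := (tendsto_one_div_add_atTop_nhds_zero_nat (𝕜 := ℝ)).comp (tendsto_add_atTop_nat 1)
        simpa [hr, Function.comp_def] using this.const_mul (1 - lam i)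
      have ht : ∀ m, lam i + r m ∈ Ico (0 : ℝ) 1 := fun m =>
        ⟨by linarith [hli.1, hr0 m], by linarith [hr1 m]⟩
      have hq : ∀ m, Integrable (fun x => (r m)⁻¹ •
          (k x (Function.update lam i (lam i + r m)) - k x lam)) μ := fun m =>
        Integrable.smul (r m)⁻¹ (f := fun x => k x (Function.update lam i (lam i + r m)) - k x lam)
          ((hi _ (update_mem_unitCube hl i (ht m))).sub (hi _ hl))
      have hest : ∀ x m, ‖(r m)⁻¹ • (k x (Function.update lam i (lam i + r m)) - k x lam)
          - pderivOrth (k x) i lam‖ ≤ b x * r m := by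
        intro x m
        have h3 := (hk x).1 lam hl _ (ht m)
        rw [add_sub_cancel_left] at h3
        have : (r m)⁻¹ • (k x (Function.update lam i (lam i + r m)) - k x lam)
            - pderivOrth (k x) i lam = (r m)⁻¹ •
            (k x (Function.update lam i (lam i + r m)) - k x lam - r m • pderivOrth (k x) i lam) := by
          rw [smul_sub _ (_ - _), smul_smul, inv_mul_cancel₀ (hr0 m).ne', one_smul]
        rw [this, norm_smul, norm_inv, Real.norm_of_nonneg (hr0 m).le, inv_mul_le_iff₀ (hr0 m)]
        linarith
      have hmeas : AEStronglyMeasurable (fun x => pderivOrth (k x) i lam) μ := by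
        refine aestronglyMeasurable_of_tendsto_ae atTop (fun m => (hq m).1) (ae_of_all _ fun x => ?_)
        rw [tendsto_iff_norm_sub_tendsto_zero]
        refine squeeze_zero (fun _ => norm_nonneg _) (hest x) ?_
        simpa using hrl.const_mul (b x)
      refine Integrable.mono' (g := fun x => ‖(r 0)⁻¹ •
          (k x (Function.update lam i (lam i + r 0)) - k x lam)‖ + b x * r 0)
        ((hq 0).norm.add (hb.mul_const _)) hmeas (ae_of_all _ fun x => ?_)
      have := norm_sub_norm_le (pderivOrth (k x) i lam)
        ((r 0)⁻¹ • (k x (Function.update lam i (lam i + r 0)) - k x lam))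
      have h2 := hest x 0
      rw [norm_sub_rev] at h2
      linarith
    refine (TaylorBound.of_step (F' := fun lam => ∫ x, pderivOrth (k x) i lam ∂μ)
      (fun lam hl t ht => ?_) (ih (fun x => (hk x).2) hint)).1
    have hu := hi _ (update_mem_unitCube hl i ht)
    have hd : Integrable (fun x => k x (Function.update lam i t) - k x lam) μ := hu.sub (hi _ hl)
    have hs : Integrable (fun x => (t - lam i) • pderivOrth (k x) i lam) μ :=
      (hint lam hl).smul (t - lam i)
    rw [← integral_smul, ← integral_sub hu (hi _ hl), ← integral_sub hd hs, ← integral_mul_const]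
    exact norm_integral_le_of_norm_le (hb.mul_const _)
      (ae_of_all _ fun x => (hk x).1 lam hl t ht)

theorem norm_taylor_le {g g' g'' : ℝ → ℂ} {C : ℝ} (hg : ∀ t, HasDerivAt g (g' t) t)
    (hg' : ∀ t, HasDerivAt g' (g'' t) t) (hC : ∀ t ∈ Icc (0 : ℝ) 1, ‖g'' t‖ ≤ C) {a t : ℝ}
    (ha : a ∈ Icc (0 : ℝ) 1) (ht : t ∈ Icc (0 : ℝ) 1) :
    ‖g t - g a - (t - a) • g' a‖ ≤ C * (t - a) ^ 2 := by
  have h1 : ∀ τ ∈ Icc (0 : ℝ) 1, ‖g' τ - g' a‖ ≤ C * ‖τ - a‖ := fun τ hτ =>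
    (convex_Icc (0 : ℝ) 1).norm_image_sub_le_of_norm_hasDerivWithin_le
      (fun x _ => (hg' x).hasDerivWithinAt) hC ha hτ
  have hsub : uIcc a t ⊆ Icc (0 : ℝ) 1 := ordConnected_Icc.uIcc_subset ha ht
  have hC0 : 0 ≤ C := (norm_nonneg _).trans (hC a ha)
  have h2 := (convex_uIcc a t).norm_image_sub_le_of_norm_hasDerivWithin_le
    (f := fun τ => g τ - τ • g' a) (f' := fun τ => g' τ - (1 : ℝ) • g' a) (C := C * |t - a|)
    (fun x _ => ((hg x).sub ((hasDerivAt_id x).smul_const (g' a))).hasDerivWithinAt)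
    (fun x hx => by
      rw [one_smul]
      refine (h1 x (hsub hx)).trans (mul_le_mul_of_nonneg_left ?_ hC0)
      rw [Real.norm_eq_abs]
      exact abs_sub_left_of_mem_uIcc hx)
    left_mem_uIcc right_mem_uIcc
  calc ‖g t - g a - (t - a) • g' a‖ = ‖g t - t • g' a - (g a - a • g' a)‖ := by
        rw [sub_smul]; congr 1; abel
    _ ≤ _ := h2
    _ = _ := by rw [Real.norm_eq_abs, mul_assoc, ← sq, sq_abs]

theorem TaylorBound.of_contDiff {V : Type*} [NormedAddCommGroup V] [NormedSpace ℝ V]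
    {Q : Set V} (hQ : IsCompact Q) (l : List (Fin s)) {H : V × (Fin s → ℝ) → ℂ}
    (hH : ContDiff ℝ ∞ H) : ∃ C, ∀ v ∈ Q, TaylorBound C l fun lam => H (v, lam) := by
  have hder : ∀ {H : V × (Fin s → ℝ) → ℂ} (i : Fin s), ContDiff ℝ ∞ H →
      ContDiff ℝ ∞ fun p => fderiv ℝ H p (0, Pi.single i 1) := fun i hH =>
    (hH.fderiv_right (by simp)).clm_apply contDiff_const
  have hd : ∀ {H : V × (Fin s → ℝ) → ℂ} (i : Fin s), ContDiff ℝ ∞ H → ∀ v lam t,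
      HasDerivAt (fun t => H (v, Function.update lam i t))
        (fderiv ℝ H (v, Function.update lam i t) (0, Pi.single i 1)) t := fun i hH v lam t =>
    ((hH.differentiable (by simp)) _).hasFDerivAt.comp_hasDerivAt t
      ((hasDerivAt_const t v).prodMk (hasDerivAt_update lam i t))
  induction l generalizing H with
  | nil => exact ⟨0, fun _ _ => trivial⟩
  | cons i l ih =>
    obtain ⟨C₁, h₁⟩ := ih (hder i hH)
    obtain ⟨C₂, h₂⟩ := (hQ.prod (isCompact_univ_pi fun _ : Fin s =>
      isCompact_Icc (a := (0 : ℝ)) (b := 1))).exists_bound_of_continuousOn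
      (hder i (hder i hH)).continuous.continuousOn
    refine ⟨max C₁ C₂, fun v hv => (TaylorBound.of_step (fun lam hl t ht => ?_)
      ((h₁ v hv).mono (le_max_left _ _))).1⟩
    have := norm_taylor_le (C := max C₁ C₂) (hd i hH v lam) (hd i (hder i hH) v lam)
      (fun τ hτ => (h₂ _ ⟨hv, fun j _ => ?_⟩).trans (le_max_right _ _))
      (Ico_subset_Icc_self (hl i (mem_univ _))) (Ico_subset_Icc_self ht)
    · simpa using this
    · by_cases h : j = i
      · subst h; simpa using hτ
      · simpa [h] using Ico_subset_Icc_self (hl j (mem_univ _))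

end TaylorBound

section ConvexBodyIntegral

variable {E : Type*} [NormedAddCommGroup E] [NormedSpace ℝ E]

theorem ConvexBody.coe_sum {ι : Type*} (T : Finset ι) (A : ι → ConvexBody E) :
    ((∑ i ∈ T, A i : ConvexBody E) : Set E) = ∑ i ∈ T, (A i : Set E) := by
  classical
  induction T using Finset.induction_on with
  | empty => simp
  | insert i T hi ih => rw [Finset.sum_insert hi, Finset.sum_insert hi, ConvexBody.coe_add, ih]

theorem ConvexBody.dist_add_right_le (K L C : ConvexBody E) :
    dist (K + C) (L + C) ≤ dist K L := by
  refine le_of_forall_pos_le_add fun ε hε => ?_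
  have hr : Metric.hausdorffDist (K : Set E) L < dist K L + ε := by simpa using hε
  refine Metric.hausdorffDist_le_of_mem_dist (by positivity) ?_ ?_
  · rintro _ ⟨k, hk, c, hc, rfl⟩
    obtain ⟨l, hl, h⟩ := Metric.exists_dist_lt_of_hausdorffDist_lt hk hr
      ConvexBody.hausdorffEDist_ne_top
    exact ⟨l + c, ⟨l, hl, c, hc, rfl⟩, by simpa using h.le⟩
  · rintro _ ⟨l, hl, c, hc, rfl⟩
    obtain ⟨k, hk, h⟩ := Metric.exists_dist_lt_of_hausdorffDist_lt' hl hr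
      ConvexBody.hausdorffEDist_ne_top
    exact ⟨k + c, ⟨k, hk, c, hc, rfl⟩, by simpa [dist_comm] using h.le⟩

theorem ConvexBody.continuous_add_right (C : ConvexBody E) :
    Continuous fun K : ConvexBody E => K + C :=
  (LipschitzWith.of_dist_le_mul (K := 1) fun K L => by
    simpa using ConvexBody.dist_add_right_le K L C).continuous

/-- If a closed ball of radius `r` around `y` is contained in `K` and `K` lies within distance
`δ < r` of the convex closed set `L`, then `y ∈ L`. -/
theorem mem_of_closedBall_subset_of_near {K L : Set E} (hLc : Convex ℝ L) (hL : IsClosed L)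
    {r δ : ℝ} (hδ : δ < r) {y : E} (hr : 0 ≤ r) (hK : Metric.closedBall y r ⊆ K)
    (h : ∀ x ∈ K, ∃ z ∈ L, dist x z ≤ δ) : y ∈ L := by
  by_contra hy
  have hne : L.Nonempty := let ⟨z, hz, _⟩ := h y (hK (Metric.mem_closedBall_self hr)); ⟨z, hz⟩
  obtain ⟨w, u, h1, h2⟩ := geometric_hahn_banach_closed_point hLc hL hy
  have hw : w ≠ 0 := by
    rintro rfl
    obtain ⟨z, hz⟩ := hne
    have := h1 z hz
    simp at this h2
    linarith
  have key : ∀ v : E, ‖v‖ ≤ 1 → r * w v ≤ ‖w‖ * δ := by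
    intro v hv
    obtain ⟨z, hz, hd⟩ := h (y + r • v) (hK (by
      rw [mem_closedBall_iff_norm, add_sub_cancel_left, norm_smul, Real.norm_of_nonneg hr]
      nlinarith))
    have h3 : w (y + r • v - z) ≤ ‖w‖ * δ := by
      refine (le_abs_self _).trans ((w.le_opNorm _).trans ?_)
      rw [← dist_eq_norm]
      gcongr
    have h4 := h1 z hz
    simp only [map_add, map_sub, map_smul, smul_eq_mul] at h3
    linarith
  have hw0 : 0 < ‖w‖ := norm_pos_iff.2 hw
  have hr0 : 0 < r := by
    obtain ⟨z, hz, hd⟩ := h y (hK (Metric.mem_closedBall_self hr))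
    linarith [dist_nonneg.trans hd]
  have : ‖w‖ ≤ ‖w‖ * δ / r := by
    refine w.opNorm_le_of_unit_norm (C := ‖w‖ * δ / r) ?_ fun v hv => ?_
    · have := key 0 (by simp)
      rw [map_zero, mul_zero] at this
      positivity
    · rw [Real.norm_eq_abs, abs_le', le_div_iff₀ hr0, le_div_iff₀ hr0]
      refine ⟨by linarith [key v hv.le], ?_⟩
      have := key (-v) (by rw [norm_neg]; exact hv.le)
      rw [map_neg] at this
      linarith
  rw [le_div_iff₀ hr0] at this
  nlinarith

theorem ConvexBody.eventually_mem_of_mem_interior (K : ConvexBody E) {y : E}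
    (hy : y ∈ interior (K : Set E)) : ∀ᶠ L : ConvexBody E in 𝓝 K, y ∈ (L : Set E) := by
  obtain ⟨r, hr, hK⟩ := Metric.nhds_basis_closedBall.mem_iff.1 (mem_interior_iff_mem_nhds.1 hy)
  filter_upwards [Metric.ball_mem_nhds K (half_pos hr)] with L hL
  refine mem_of_closedBall_subset_of_near L.convex L.isClosed (half_lt_self hr) hr.le hK
    fun x hx => ?_
  obtain ⟨z, hz, h⟩ := Metric.exists_dist_lt_of_hausdorffDist_lt hx
    (show Metric.hausdorffDist (K : Set E) L < r / 2 by rw [hausdorffDist_coe, dist_comm]; exact hL)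
    ConvexBody.hausdorffEDist_ne_top
  exact ⟨z, hz, h.le⟩

theorem ConvexBody.eventually_notMem (K : ConvexBody E) {y : E} (hy : y ∉ (K : Set E)) :
    ∀ᶠ L : ConvexBody E in 𝓝 K, y ∉ (L : Set E) := by
  have hd := (K.isClosed.notMem_iff_infDist_pos K.nonempty).1 hy
  filter_upwards [Metric.ball_mem_nhds K hd] with L hL hyL
  obtain ⟨z, hz, h⟩ := Metric.exists_dist_lt_of_hausdorffDist_lt hyL
    (show Metric.hausdorffDist (L : Set E) K < _ from hL) ConvexBody.hausdorffEDist_ne_top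
  exact absurd (Metric.infDist_le_dist_of_mem hz) (not_le.2 h)

theorem ConvexBody.eventually_subset_closedBall (K : ConvexBody E) {R : ℝ}
    (hR : (K : Set E) ⊆ Metric.closedBall 0 R) :
    ∀ᶠ L : ConvexBody E in 𝓝 K, (L : Set E) ⊆ Metric.closedBall 0 (R + 1) := by
  filter_upwards [Metric.ball_mem_nhds K one_pos] with L hL x hx
  obtain ⟨z, hz, h⟩ := Metric.exists_dist_lt_of_hausdorffDist_lt hx
    (show Metric.hausdorffDist (L : Set E) K < _ from hL) ConvexBody.hausdorffEDist_ne_top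
  rw [Metric.mem_closedBall]
  linarith [dist_triangle x z 0, Metric.mem_closedBall.1 (hR hz)]

theorem inter_add_eq_of_convex_union {K L B : Set E} (hK : IsClosed K) (hL : IsClosed L)
    (hU : Convex ℝ (K ∪ L)) (hB : Convex ℝ B) : (K ∩ L) + B = (K + B) ∩ (L + B) := by
  refine (inter_add_subset).antisymm ?_
  rintro _ ⟨⟨k, hk, b, hb, rfl⟩, ⟨l, hl, b', hb', h⟩⟩
  have hseg : segment ℝ k l ⊆ K ∪ L := hU.segment_subset (Or.inl hk) (Or.inr hl)
  obtain ⟨m, ⟨c, d, hc, hd, hcd, rfl⟩, hmK, hmL⟩ := isPreconnected_closed_iff.1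
    (convex_segment k l).isPreconnected K L hK hL hseg
    ⟨k, left_mem_segment _ _ _, hk⟩ ⟨l, right_mem_segment _ _ _, hl⟩
  refine ⟨_, ⟨hmK, hmL⟩, c • b + d • b', hB hb hb' hc hd hcd, ?_⟩
  have h' : l + b' = k + b := h
  calc c • k + d • l + (c • b + d • b') = c • (k + b) + d • (l + b') := by
        simp only [smul_add]; abel
    _ = k + b := by rw [h', ← add_smul, hcd, one_smul]

variable [MeasurableSpace E] [BorelSpace E]
  (μ : Measure E) [μ.IsAddHaarMeasure]

theorem ConvexBody.continuous_setIntegral [FiniteDimensional ℝ E] {f : E → ℂ} (hf : Continuous f) :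
    Continuous fun K : ConvexBody E => ∫ y in (K : Set E), f y ∂μ := by
  rw [continuous_iff_continuousAt]
  intro K
  obtain ⟨R, hR⟩ := K.isBounded.subset_closedBall 0
  simp_rw [ContinuousAt, ← integral_indicator (ConvexBody.isClosed _).measurableSet]
  refine tendsto_integral_filter_of_dominated_convergence
    ((Metric.closedBall (0 : E) (R + 1)).indicator fun y => ‖f y‖) ?_ ?_ ?_ ?_
  · exact Eventually.of_forall fun L =>
      (hf.aestronglyMeasurable).indicator L.isClosed.measurableSet
  · filter_upwards [K.eventually_subset_closedBall hR] with L hL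
    refine ae_of_all _ fun y => ?_
    rw [norm_indicator_eq_indicator_norm]
    exact indicator_le_indicator_of_subset hL (fun _ => norm_nonneg _) y
  · rw [integrable_indicator_iff Metric.isClosed_closedBall.measurableSet]
    exact hf.norm.continuousOn.integrableOn_compact (isCompact_closedBall _ _)
  · have := measure_eq_zero_iff_ae_notMem.1 (K.convex.addHaar_frontier μ)
    filter_upwards [this] with y hy
    by_cases hyK : y ∈ (K : Set E)
    · have hyi : y ∈ interior (K : Set E) := by
        by_contra h
        exact hy ⟨subset_closure hyK, h⟩
      refine tendsto_const_nhds.congr' ?_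
      filter_upwards [K.eventually_mem_of_mem_interior hyi] with L hL
      rw [indicator_of_mem hyK, indicator_of_mem hL]
    · refine tendsto_const_nhds.congr' ?_
      filter_upwards [K.eventually_notMem hyK] with L hL
      rw [indicator_of_notMem hyK, indicator_of_notMem hL]

theorem ConvexBody.setIntegral_union_add_inter {f : E → ℂ} (hf : Continuous f)
    {K L M N : ConvexBody E} (hM : (M : Set E) = (K : Set E) ∪ L)
    (hN : (N : Set E) = (K : Set E) ∩ L) (B : ConvexBody E) :
    ∫ y in ((M + B : ConvexBody E) : Set E), f y ∂μ + ∫ y in ((N + B : ConvexBody E) : Set E), f y ∂μ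
      = ∫ y in ((K + B : ConvexBody E) : Set E), f y ∂μ
        + ∫ y in ((L + B : ConvexBody E) : Set E), f y ∂μ := by
  have h1 : ((M + B : ConvexBody E) : Set E)
      = ((K + B : ConvexBody E) : Set E) ∪ ((L + B : ConvexBody E) : Set E) := by
    simp only [coe_add, hM, union_add]
  have h2 : ((N + B : ConvexBody E) : Set E)
      = ((K + B : ConvexBody E) : Set E) ∩ ((L + B : ConvexBody E) : Set E) := by
    simp only [coe_add, hN]
    exact inter_add_eq_of_convex_union K.isClosed L.isClosed (hM ▸ M.convex) B.convex
  rw [h1, h2]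
  have hi : ∀ C : ConvexBody E, Integrable f (μ.restrict (C : Set E)) := fun C =>
    hf.continuousOn.integrableOn_compact C.isCompact
  have hm := Measure.restrict_union_add_inter (μ := μ) ((K + B : ConvexBody E) : Set E)
    (L + B).isClosed.measurableSet
  rw [← integral_add_measure (h1 ▸ hi (M + B)) (h2 ▸ hi (N + B)), hm,
    integral_add_measure (hi _) (hi _)]

end ConvexBodyIntegral

section Potential

variable {E : Type*} [NormedAddCommGroup E] [InnerProductSpace ℝ E]

/-- A monotone `C¹` gradient field `G = ∇u` with values in `C`, whose potential `u` dominates the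
support function of `C` up to a constant. -/
structure IsPotential (C : Set E) (u : E → ℝ) (G : E → E) : Prop where
  contDiff : ContDiff ℝ 1 G
  hasFDerivAt : ∀ x, HasFDerivAt u (innerSL ℝ (G x)) x
  mem : ∀ x, G x ∈ C
  mono : ∀ x y, 0 ≤ inner ℝ (G x - G y) (x - y)
  bound : ∃ c, ∀ a ∈ C, ∀ x, inner ℝ a x ≤ u x + c

namespace IsPotential

variable {C C' : Set E} {u u' : E → ℝ} {G G' : E → E}

theorem add (h : IsPotential C u G) (h' : IsPotential C' u' G') :
    IsPotential (C + C') (u + u') (G + G') where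
  contDiff := h.contDiff.add h'.contDiff
  hasFDerivAt x := by
    rw [Pi.add_apply, map_add]
    exact (h.hasFDerivAt x).add (h'.hasFDerivAt x)
  mem x := add_mem_add (h.mem x) (h'.mem x)
  mono x y := by
    have : (G + G') x - (G + G') y = (G x - G y) + (G' x - G' y) := by
      simp only [Pi.add_apply]; abel
    rw [this, inner_add_left]
    exact add_nonneg (h.mono x y) (h'.mono x y)
  bound := by
    obtain ⟨c, hc⟩ := h.bound
    obtain ⟨c', hc'⟩ := h'.bound
    refine ⟨c + c', ?_⟩
    rintro _ ⟨a, ha, a', ha', rfl⟩ x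
    have h1 := hc a ha x
    have h2 := hc' a' ha' x
    simp only [inner_add_left, Pi.add_apply]
    linarith

theorem smul (h : IsPotential C u G) {t : ℝ} (ht : 0 ≤ t) :
    IsPotential (t • C) (t • u) (t • G) where
  contDiff := contDiff_const.smul h.contDiff
  hasFDerivAt x := by
    have : innerSL ℝ ((t • G) x) = t • innerSL ℝ (G x) := by
      ext; simp
    rw [this]
    exact (h.hasFDerivAt x).const_smul t
  mem x := smul_mem_smul_set (h.mem x)
  mono x y := by
    rw [Pi.smul_apply, Pi.smul_apply, ← smul_sub, real_inner_smul_left]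
    exact mul_nonneg ht (h.mono x y)
  bound := by
    obtain ⟨c, hc⟩ := h.bound
    refine ⟨t * c, ?_⟩
    rintro _ ⟨a, ha, rfl⟩ x
    simp only [real_inner_smul_left, Pi.smul_apply, smul_eq_mul]
    rw [← mul_add]
    exact mul_le_mul_of_nonneg_left (hc a ha x) ht

theorem zero : IsPotential (0 : Set E) 0 0 where
  contDiff := contDiff_const
  hasFDerivAt x := by
    rw [Pi.zero_apply, map_zero]
    exact hasFDerivAt_const 0 x
  mem x := rfl
  mono x y := by simp
  bound := ⟨0, by simp⟩

theorem sum {ι : Type*} (T : Finset ι) {C : ι → Set E} {u : ι → E → ℝ} {G : ι → E → E}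
    (h : ∀ i ∈ T, IsPotential (C i) (u i) (G i)) :
    IsPotential (∑ i ∈ T, C i) (∑ i ∈ T, u i) (∑ i ∈ T, G i) := by
  classical
  induction T using Finset.induction_on with
  | empty => simpa using zero
  | insert i T hi ih =>
    simp only [Finset.sum_insert hi]
    exact (h i (Finset.mem_insert_self _ _)).add
      (ih fun j hj => h j (Finset.mem_insert_of_mem hj))

theorem inner_fderiv_nonneg (h : IsPotential C u G) (x v : E) :
    0 ≤ inner ℝ (fderiv ℝ G x v) v := by
  have hd : HasDerivAt (fun t : ℝ => G (x + t • v)) (fderiv ℝ G x v) 0 := by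
    have h1 : HasDerivAt (fun t : ℝ => x + t • v) v 0 := by
      simpa using ((hasDerivAt_id (0 : ℝ)).smul_const v).const_add x
    have h2 : HasFDerivAt G (fderiv ℝ G x) (x + (0 : ℝ) • v) := by
      simpa using ((h.contDiff.differentiable (by simp)) x).hasFDerivAt
    exact h2.comp_hasDerivAt 0 h1
  have hlim : Tendsto (fun t => inner ℝ (slope (fun t : ℝ => G (x + t • v)) 0 t) v) (𝓝[≠] 0)
      (𝓝 (inner ℝ (fderiv ℝ G x v) v)) :=
    Filter.Tendsto.inner (hasDerivAt_iff_tendsto_slope.1 hd) tendsto_const_nhds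
  refine ge_of_tendsto hlim ?_
  filter_upwards [self_mem_nhdsWithin] with t ht
  have hm := h.mono (x + t • v) x
  rw [add_sub_cancel_left, real_inner_smul_right] at hm
  rw [slope_def_module, zero_smul, add_zero, sub_zero, real_inner_smul_left]
  have ht0 : t ≠ 0 := ht
  have ht2 : 0 < t ^ 2 := by positivity
  have : t⁻¹ * inner ℝ (G (x + t • v) - G x) v
      = (t ^ 2)⁻¹ * (t * inner ℝ (G (x + t • v) - G x) v) := by
    field_simp
  rw [this]
  positivity

variable [FiniteDimensional ℝ E]

theorem _root_.ContinuousLinearMap.det_nonneg_of_inner_nonneg {T : E →L[ℝ] E}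
    (hT : ∀ v, 0 ≤ inner ℝ (T v) v) : 0 ≤ T.det := by
  set p : ℝ → ℝ := fun t => ((1 - t) • ContinuousLinearMap.id ℝ E + t • T).det with hp
  have hc : Continuous p := ContinuousLinearMap.continuous_det.comp (by fun_prop)
  have hne : ∀ t ∈ Ico (0 : ℝ) 1, p t ≠ 0 := by
    intro t ht h0
    have : ¬ Function.Injective ((1 - t) • ContinuousLinearMap.id ℝ E + t • T : E →L[ℝ] E) := by
      intro hinj
      have hu := (LinearMap.isUnit_iff_ker_eq_bot
        (((1 - t) • ContinuousLinearMap.id ℝ E + t • T : E →L[ℝ] E) : E →ₗ[ℝ] E)).2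
        (LinearMap.ker_eq_bot.2 hinj)
      exact (LinearMap.isUnit_det _ hu).ne_zero h0
    rw [← ContinuousLinearMap.coe_coe, injective_iff_map_eq_zero] at this
    push Not at this
    obtain ⟨v, hv, hv0⟩ := this
    have h1 : inner ℝ (((1 - t) • ContinuousLinearMap.id ℝ E + t • T) v) v = (0 : ℝ) := by
      rw [show ((1 - t) • ContinuousLinearMap.id ℝ E + t • T) v = 0 from hv, inner_zero_left]
    simp only [add_apply, smul_apply,
      ContinuousLinearMap.id_apply, inner_add_left, real_inner_smul_left,
      real_inner_self_eq_norm_sq] at h1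
    have h2 : 0 < (1 - t) * ‖v‖ ^ 2 := by
      have := norm_pos_iff.2 hv0
      have := ht.2
      have : 0 < 1 - t := by linarith
      positivity
    have h3 := mul_nonneg ht.1 (hT v)
    linarith
  have hpos : ∀ t ∈ Ico (0 : ℝ) 1, 0 < p t := by
    intro t ht
    by_contra hneg
    have h0 : p 0 = 1 := by simp [hp, ContinuousLinearMap.det]
    obtain ⟨τ, hτ, hτ0⟩ := intermediate_value_Icc' ht.1 hc.continuousOn
      (show (0 : ℝ) ∈ Icc (p t) (p 0) from ⟨not_lt.1 hneg, by rw [h0]; exact zero_le_one⟩)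
    exact hne τ ⟨hτ.1, hτ.2.trans_lt ht.2⟩ hτ0
  have h1 : p 1 = T.det := by simp [hp]
  rw [← h1]
  have hlim : Tendsto p (𝓝[<] 1) (𝓝 (p 1)) := hc.continuousAt.mono_left nhdsWithin_le_nhds
  refine ge_of_tendsto hlim ?_
  filter_upwards [Ico_mem_nhdsLT (zero_lt_one' ℝ)] with t ht using (hpos t ht).le

theorem det_fderiv_nonneg (h : IsPotential C u G) (x : E) : 0 ≤ (fderiv ℝ G x).det :=
  ContinuousLinearMap.det_nonneg_of_inner_nonneg (h.inner_fderiv_nonneg x)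

theorem interior_subset_range (h : IsPotential C u G) : interior C ⊆ range G := by
  intro y hy
  obtain ⟨r, hr, hK⟩ := Metric.nhds_basis_closedBall.mem_iff.1 (mem_interior_iff_mem_nhds.1 hy)
  obtain ⟨c, hc⟩ := h.bound
  have hu : Continuous u := continuous_iff_continuousAt.2 fun x => (h.hasFDerivAt x).continuousAt
  have hlow : ∀ x, r * ‖x‖ - c ≤ u x - inner ℝ y x := by
    intro x
    by_cases hx : x = 0
    · subst hx
      have := hc y (interior_subset hy) 0
      simp only [inner_zero_right, norm_zero] at this ⊢
      linarith
    · have hx0 : 0 < ‖x‖ := norm_pos_iff.2 hx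
      have := hc (y + (r * ‖x‖⁻¹) • x) (hK (by
        rw [mem_closedBall_iff_norm, add_sub_cancel_left, norm_smul, norm_mul, norm_inv, norm_norm,
          mul_assoc, inv_mul_cancel₀ hx0.ne', mul_one, Real.norm_of_nonneg hr.le])) x
      rw [inner_add_left, real_inner_smul_left, real_inner_self_eq_norm_sq] at this
      have e : r * ‖x‖⁻¹ * ‖x‖ ^ 2 = r * ‖x‖ := by field_simp
      linarith
  have hcoer : Tendsto (fun x => u x - inner ℝ y x) (cocompact E) atTop := by
    refine tendsto_atTop_mono hlow ?_
    exact tendsto_atTop_add_const_right _ _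
      ((tendsto_norm_cocompact_atTop (E := E)).const_mul_atTop hr)
  obtain ⟨x, hx⟩ := (hu.sub (continuous_const.inner continuous_id)).exists_forall_le hcoer
  refine ⟨x, ?_⟩
  have hmin : IsLocalMin (fun x => u x - inner ℝ y x) x := Eventually.of_forall hx
  have hfd : HasFDerivAt (fun x => u x - inner ℝ y x) (innerSL ℝ (G x) - innerSL ℝ y) x :=
    (h.hasFDerivAt x).sub (innerSL ℝ y).hasFDerivAt
  have h0 := hmin.hasFDerivAt_eq_zero hfd
  rw [← map_sub] at h0
  have := congrArg (fun T : E →L[ℝ] ℝ => T (G x - y)) h0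
  simp only [innerSL_apply_apply, zero_apply, inner_self_eq_zero] at this
  exact sub_eq_zero.1 this

variable [MeasurableSpace E] [BorelSpace E] {F : Type*} [NormedAddCommGroup F] [NormedSpace ℝ F]
  (μ : Measure E) [μ.IsAddHaarMeasure]

/-- Change of variables along a strictly monotone gradient field. -/
theorem setIntegral_eq (h : IsPotential C u G) (hC : Convex ℝ C)
    (hinj : ∀ x y, x ≠ y → 0 < inner ℝ (G x - G y) (x - y)) {f : E → F}
    (hf : IntegrableOn f C μ) :
    Integrable (fun x => (fderiv ℝ G x).det • f (G x)) μ ∧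
      ∫ y in C, f y ∂μ = ∫ x, (fderiv ℝ G x).det • f (G x) ∂μ := by
  have hae : range G =ᵐ[μ] C := by
    refine ((range_subset_iff.2 h.mem).eventuallyLE).antisymm ?_
    refine ae_le_set.2 (measure_mono_null ?_ (hC.addHaar_frontier μ))
    exact fun y hy => ⟨subset_closure hy.1, fun hi => hy.2 (h.interior_subset_range hi)⟩
  have hinj' : InjOn G univ := by
    intro x _ y _ hxy
    by_contra hne
    have := hinj x y hne
    rw [hxy, sub_self, inner_zero_left] at this
    exact lt_irrefl _ this
  have hder : ∀ x ∈ univ, HasFDerivWithinAt G (fderiv ℝ G x) univ x := fun x _ =>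
    ((h.contDiff.differentiable (by simp)) x).hasFDerivAt.hasFDerivWithinAt
  have h1 := integrableOn_image_iff_integrableOn_abs_det_fderiv_smul μ MeasurableSet.univ
    hder hinj' f
  have h2 := integral_image_eq_integral_abs_det_fderiv_smul μ MeasurableSet.univ hder hinj' f
  simp only [image_univ, integrableOn_univ, Measure.restrict_univ,
    abs_of_nonneg (h.det_fderiv_nonneg _)] at h1 h2
  exact ⟨h1.1 (hf.congr_set_ae hae), by rw [← h2, setIntegral_congr_set hae]⟩

end IsPotential

end Potential

section Potential

variable {E : Type*} [NormedAddCommGroup E] [InnerProductSpace ℝ E]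

/-- `h` is the support function of `C`, with the supremum attained. -/
structure IsSupportFun (C : Set E) (h : E → ℝ) : Prop where
  inner_le : ∀ a ∈ C, ∀ x, inner ℝ a x ≤ h x
  exists_eq : ∀ x, ∃ a ∈ C, h x = inner ℝ a x

namespace IsSupportFun

variable {C : Set E} {h : E → ℝ}

theorem add_le (hh : IsSupportFun C h) (x y : E) : h (x + y) ≤ h x + h y := by
  obtain ⟨a, ha, he⟩ := hh.exists_eq (x + y)
  rw [he, inner_add_right]
  exact add_le_add (hh.inner_le a ha x) (hh.inner_le a ha y)

theorem map_smul_le (hh : IsSupportFun C h) {t : ℝ} (ht : 0 ≤ t) (x : E) :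
    h (t • x) ≤ t * h x := by
  obtain ⟨a, ha, he⟩ := hh.exists_eq (t • x)
  rw [he, real_inner_smul_right]
  exact mul_le_mul_of_nonneg_left (hh.inner_le a ha x) ht

theorem abs_sub_le (hh : IsSupportFun C h) {R : ℝ} (hR : ∀ a ∈ C, ‖a‖ ≤ R) (x y : E) :
    |h x - h y| ≤ R * ‖x - y‖ := by
  have key : ∀ x y, h x - h y ≤ R * ‖x - y‖ := by
    intro x y
    obtain ⟨a, ha, he⟩ := hh.exists_eq x
    calc h x - h y ≤ inner ℝ a (x - y) := by
          rw [inner_sub_right, he]; linarith [hh.inner_le a ha y]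
      _ ≤ ‖a‖ * ‖x - y‖ := real_inner_le_norm _ _
      _ ≤ R * ‖x - y‖ := mul_le_mul_of_nonneg_right (hR a ha) (norm_nonneg _)
  rw [abs_le]
  have := key y x
  rw [norm_sub_rev] at this
  exact ⟨by linarith, key x y⟩

theorem continuous (hh : IsSupportFun C h) {R : ℝ} (hR : ∀ a ∈ C, ‖a‖ ≤ R) : Continuous h := by
  refine (LipschitzWith.of_dist_le_mul (K := R.toNNReal) fun x y => ?_).continuous
  rw [Real.dist_eq, dist_eq_norm]
  exact (hh.abs_sub_le hR x y).trans
    (mul_le_mul_of_nonneg_right (Real.le_coe_toNNReal R) (norm_nonneg _))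

theorem convexOn (hh : IsSupportFun C h) : ConvexOn ℝ univ h :=
  ⟨convex_univ, fun x _ y _ _ _ ha hb _ => (hh.add_le _ _).trans
    (add_le_add (hh.map_smul_le ha x) (hh.map_smul_le hb y))⟩

theorem mem_of_inner_le [CompleteSpace E] (hh : IsSupportFun C h) (hC : Convex ℝ C)
    (hcl : IsClosed C) {y : E} (hy : ∀ v, inner ℝ y v ≤ h v) : y ∈ C := by
  by_contra hn
  obtain ⟨w, c, h1, h2⟩ := geometric_hahn_banach_closed_point hC hcl hn
  set v := (InnerProductSpace.toDual ℝ E).symm w with hv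
  have hw : ∀ z, w z = inner ℝ z v := fun z => by
    rw [real_inner_comm, hv, InnerProductSpace.toDual_symm_apply]
  obtain ⟨a, ha, he⟩ := hh.exists_eq v
  have := hy v
  rw [he, ← hw, ← hw] at this
  linarith [h1 a ha]

end IsSupportFun

theorem ConvexBody.exists_isSupportFun (K : ConvexBody E) :
    ∃ h : E → ℝ, IsSupportFun (K : Set E) h := by
  have : ∀ x : E, ∃ a ∈ (K : Set E), IsMaxOn (fun a => inner ℝ a x) (K : Set E) a := fun x =>
    K.isCompact.exists_isMaxOn K.nonempty (by fun_prop)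
  choose a ha hmax using this
  exact ⟨fun x => inner ℝ (a x) x, fun b hb x => hmax x hb, fun x => ⟨a x, ha x, rfl⟩⟩

theorem ConvexOn.inner_gradient_le {u : E → ℝ} (hu : ConvexOn ℝ univ u) {x g : E}
    (hg : HasFDerivAt u (innerSL ℝ g) x) (v : E) : inner ℝ g v ≤ u (x + v) - u x := by
  have hc : ConvexOn ℝ univ (fun t : ℝ => u (AffineMap.lineMap x (x + v) t)) := by
    have := hu.comp_affineMap (AffineMap.lineMap x (x + v))
    rwa [preimage_univ] at this
  have hd : HasDerivAt (fun t : ℝ => u (AffineMap.lineMap x (x + v) t)) (inner ℝ g v) 0 := by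
    have h1 : HasDerivAt (fun t : ℝ => AffineMap.lineMap x (x + v) t) v 0 := by
      simpa using (AffineMap.hasDerivAt_lineMap (a := x) (b := x + v) (x := (0 : ℝ)))
    have h2 : HasFDerivAt u (innerSL ℝ g) (AffineMap.lineMap x (x + v) (0 : ℝ)) := by
      simpa using hg
    exact h2.comp_hasDerivAt 0 h1
  simpa [slope_def_field] using
    hc.le_slope_of_hasDerivAt (mem_univ 0) (mem_univ 1) zero_lt_one hd

variable [FiniteDimensional ℝ E] [MeasurableSpace E] [BorelSpace E]

open scoped Convolution in
/-- The mollified support function is a potential. -/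
theorem ConvexBody.exists_isPotential (μ : Measure E) [μ.IsAddHaarMeasure] (K : ConvexBody E) :
    ∃ u G, IsPotential (K : Set E) u G := by
  obtain ⟨h, hh⟩ := K.exists_isSupportFun
  obtain ⟨R, hR'⟩ := K.isBounded.subset_closedBall 0
  have hR : ∀ a ∈ (K : Set E), ‖a‖ ≤ R := fun a ha => by simpa using hR' ha
  have hR0 : 0 ≤ R := let ⟨a, ha⟩ := K.nonempty; (norm_nonneg a).trans (hR a ha)
  have hcont := hh.continuous hR
  let φ : ContDiffBump (0 : E) := default
  set ρ : E → ℝ := φ.normed μ with hρ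
  set u : E → ℝ := (ρ ⋆[ContinuousLinearMap.lsmul ℝ ℝ, μ] h : E → ℝ) with hu
  have hu_apply : ∀ x, u x = ∫ t, ρ t * h (x - t) ∂μ := fun x => rfl
  have hint : ∀ x, Integrable (fun t => ρ t * h (x - t)) μ := fun x =>
    (φ.hasCompactSupport_normed.convolutionExists_left (ContinuousLinearMap.lsmul ℝ ℝ)
      φ.continuous_normed hcont.locallyIntegrable) x
  have hρi : Integrable ρ μ := φ.integrable_normed
  have hsmooth : ContDiff ℝ 2 u :=
    φ.hasCompactSupport_normed.contDiff_convolution_left _ (φ.contDiff_normed (n := 2))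
      hcont.locallyIntegrable
  have hadd : ∀ x v, u (x + v) ≤ u x + h v := by
    intro x v
    have : h v = ∫ t, ρ t * h v ∂μ := by
      rw [integral_mul_const, φ.integral_normed, one_mul]
    rw [this, hu_apply, hu_apply, ← integral_add (hint x) (hρi.mul_const _)]
    refine integral_mono (hint _) ((hint x).add (hρi.mul_const _)) fun t => ?_
    have h1 := hh.add_le (x - t) v
    rw [sub_add_eq_add_sub] at h1
    simp only [← mul_add]
    exact mul_le_mul_of_nonneg_left h1 (φ.nonneg_normed t)
  have hconv : ConvexOn ℝ univ u := by
    refine ⟨convex_univ, fun x _ y _ a b ha hb hab => ?_⟩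
    simp only [hu_apply, smul_eq_mul, ← integral_const_mul]
    rw [← integral_add ((hint x).const_mul a) ((hint y).const_mul b)]
    refine integral_mono (hint _) (((hint x).const_mul a).add ((hint y).const_mul b)) fun t => ?_
    have h1 := hh.convexOn.2 (mem_univ (x - t)) (mem_univ (y - t)) ha hb hab
    have h2 : a • (x - t) + b • (y - t) = a • x + b • y - t := by
      rw [smul_sub, smul_sub, sub_add_sub_comm, ← add_smul, hab, one_smul]
    rw [h2] at h1
    have h3 := mul_le_mul_of_nonneg_left h1 (φ.nonneg_normed (μ := μ) t)
    refine h3.trans (le_of_eq ?_)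
    simp only [smul_eq_mul, ← hρ]
    ring
  set G : E → E := fun x => (InnerProductSpace.toDual ℝ E).symm (fderiv ℝ u x) with hG
  have hder : ∀ x, HasFDerivAt u (innerSL ℝ (G x)) x := by
    intro x
    have : innerSL ℝ (G x) = fderiv ℝ u x := by
      ext v
      rw [innerSL_apply_apply, InnerProductSpace.toDual_symm_apply]
    rw [this]
    exact (hsmooth.differentiable (by simp) x).hasFDerivAt
  have hgrad : ∀ x v, inner ℝ (G x) v ≤ u (x + v) - u x := fun x v =>
    hconv.inner_gradient_le (hder x) v
  refine ⟨u, G, ?_, hder, fun x => ?_, fun x y => ?_, R * φ.rOut, fun a ha x => ?_⟩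
  · exact (InnerProductSpace.toDual ℝ E).symm.contDiff.comp (hsmooth.fderiv_right (by norm_num))
  · exact hh.mem_of_inner_le K.convex K.isClosed fun v => by linarith [hgrad x v, hadd x v]
  · have h1 := hgrad x (y - x)
    have h2 := hgrad y (x - y)
    rw [add_sub_cancel] at h1 h2
    rw [← neg_sub x y, inner_neg_right] at h1
    rw [inner_sub_left]
    linarith
  · have hd : dist (u x) (h x) ≤ R * φ.rOut := by
      refine φ.dist_normed_convolution_le hcont.aestronglyMeasurable fun y hy => ?_
      rw [Real.dist_eq]
      refine (hh.abs_sub_le hR y x).trans (mul_le_mul_of_nonneg_left ?_ hR0)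
      rw [← dist_eq_norm]
      exact (Metric.mem_ball.1 hy).le
    rw [Real.dist_eq, abs_le] at hd
    linarith [hh.inner_le a ha x, hd.1]

end Potential

section Ball

variable {E : Type*} [NormedAddCommGroup E] [InnerProductSpace ℝ E]

/-- The gradient of `x ↦ √(1 + ‖x‖²)`. -/
def ballGradient (x : E) : E := (√(1 + ‖x‖ ^ 2))⁻¹ • x

theorem inner_ballGradient_sub_pos {x y : E} (hxy : x ≠ y) :
    0 < inner ℝ (ballGradient x - ballGradient y) (x - y) := by
  set p := ‖x‖
  set q := ‖y‖
  set a := √(1 + ‖x‖ ^ 2) with ha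
  set b := √(1 + ‖y‖ ^ 2) with hb
  have ha0 : 0 < a := Real.sqrt_pos.2 (by positivity)
  have hb0 : 0 < b := Real.sqrt_pos.2 (by positivity)
  have ha2 : a ^ 2 = 1 + p ^ 2 := Real.sq_sqrt (by positivity)
  have hb2 : b ^ 2 = 1 + q ^ 2 := Real.sq_sqrt (by positivity)
  have hp : 0 ≤ p := norm_nonneg x
  have hq : 0 ≤ q := norm_nonneg y
  set c : ℝ := inner ℝ x y with hc
  have hexp : inner ℝ (ballGradient x - ballGradient y) (x - y)
      = p ^ 2 / a + q ^ 2 / b - (1 / a + 1 / b) * c := by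
    simp only [ballGradient, inner_sub_left, inner_sub_right, real_inner_smul_left,
      real_inner_self_eq_norm_sq, real_inner_comm x y]
    rw [← ha, ← hb, ← hc]
    ring
  have hcle : c ≤ p * q := real_inner_le_norm x y
  have hnorm : 0 < p ^ 2 - 2 * c + q ^ 2 := by
    rw [← norm_sub_sq_real]
    have := norm_pos_iff.2 (sub_ne_zero.2 hxy)
    positivity
  have hexp2 : p ^ 2 / a + q ^ 2 / b - (1 / a + 1 / b) * c
      = (p ^ 2 * b + q ^ 2 * a - (a + b) * c) / (a * b) := by
    field_simp
    ring
  rw [hexp, hexp2]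
  refine div_pos ?_ (by positivity)
  by_cases hpq : p = q
  · have hab : a = b := by
      rw [← sq_eq_sq₀ ha0.le hb0.le, ha2, hb2, hpq]
    have : p ^ 2 * b + q ^ 2 * a - (a + b) * c = b * (p ^ 2 - 2 * c + q ^ 2) := by
      rw [hab]; ring
    rw [this]
    positivity
  · have h1 : (a - b) * (a + b) = (p - q) * (p + q) := by ring_nf; rw [ha2, hb2]; ring
    have h2 : 0 < (p - q) * (p * b - q * a) := by
      have h3 : (p * b - q * a) * (p * b + q * a) = (p - q) * (p + q) := by
        have : (p * b - q * a) * (p * b + q * a) = p ^ 2 * b ^ 2 - q ^ 2 * a ^ 2 := by ring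
        rw [this, ha2, hb2]; ring
      have h4 : 0 < p + q := by
        rcases hp.eq_or_lt with h | h
        · rcases hq.eq_or_lt with h' | h'
          · exact absurd (h.symm.trans h') hpq
          · linarith
        · linarith
      have h5 : 0 < p * b + q * a := by
        rcases hp.eq_or_lt with h | h
        · have : 0 < q := by rw [← h] at h4; linarith
          positivity
        · positivity
      have h6 : 0 < (p - q) ^ 2 := by
        have := sub_ne_zero.2 hpq
        positivity
      have h7 : (p - q) * (p * b - q * a) * (p * b + q * a) = (p - q) ^ 2 * (p + q) := by
        rw [mul_assoc, h3]; ring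
      have h8 : 0 < (p - q) * (p * b - q * a) * (p * b + q * a) := by
        rw [h7]; positivity
      exact (pos_iff_pos_of_mul_pos h8).2 h5
    nlinarith [mul_le_mul_of_nonneg_left hcle (add_pos ha0 hb0).le]

theorem isPotential_ballGradient :
    IsPotential (Metric.closedBall (0 : E) 1) (fun x => √(1 + ‖x‖ ^ 2)) ballGradient where
  contDiff := by
    have h1 : ContDiff ℝ 1 fun x : E => √(1 + ‖x‖ ^ 2) :=
      (contDiff_const.add (contDiff_norm_sq ℝ)).sqrt fun x => by positivity
    exact (h1.inv fun x => (Real.sqrt_pos.2 (by positivity)).ne').smul contDiff_id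
  hasFDerivAt x := by
    have h1 : HasFDerivAt (fun x : E => 1 + ‖x‖ ^ 2) (2 • innerSL ℝ x) x :=
      (hasStrictFDerivAt_norm_sq x).hasFDerivAt.const_add 1
    have h2 := h1.sqrt (by positivity)
    refine h2.congr_fderiv ?_
    ext v
    simp [ballGradient]
    field_simp
  mem x := by
    rw [mem_closedBall_zero_iff, ballGradient, norm_smul, norm_inv,
      Real.norm_of_nonneg (Real.sqrt_nonneg _), inv_mul_le_one₀ (Real.sqrt_pos.2 (by positivity))]
    exact Real.le_sqrt_of_sq_le (by linarith)
  mono x y := by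
    by_cases h : x = y
    · simp [h]
    · exact (inner_ballGradient_sub_pos h).le
  bound := by
    refine ⟨0, fun a ha x => ?_⟩
    rw [mem_closedBall_zero_iff] at ha
    rw [add_zero]
    refine (real_inner_le_norm a x).trans ((mul_le_of_le_one_left (norm_nonneg x) ha).trans ?_)
    exact Real.le_sqrt_of_sq_le (by linarith)

end Ball

section Interpolation

open Polynomial in
/-- Tensor-product Lagrange interpolation at nonnegative nodes for functions that are polynomial of
degree at most `n` in each variable. -/
theorem exists_interpolation {σ : Type} [Fintype σ] [DecidableEq σ] (n : ℕ) (T : Finset σ) :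
    ∃ (ι : Type) (_ : Fintype ι) (L : ι → (σ → ℝ) → ℝ) (γ : ι → σ → ℝ),
      (∀ k, ContDiff ℝ ∞ (L k)) ∧ (∀ k i, 0 ≤ γ k i) ∧
      ∀ p : (σ → ℝ) → ℝ,
        (∀ lam i, ∃ P : ℝ[X], P.natDegree ≤ n ∧ ∀ t, p (Function.update lam i t) = P.eval t) →
        ∀ lam, p lam = ∑ k, L k lam * p (T.piecewise (γ k) lam) := by
  induction T using Finset.induction_on with
  | empty =>
    exact ⟨Unit, inferInstance, fun _ _ => 1, fun _ _ => 0, fun _ => contDiff_const,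
      fun _ _ => le_rfl, fun p _ lam => by simp⟩
  | insert a T ha ih =>
    obtain ⟨ι, _, L, γ, hL, hγ, hp⟩ := ih
    let v : Fin (n + 1) → ℝ := fun j => j
    have hv : InjOn v (Finset.univ : Finset (Fin (n + 1))) := fun i _ j _ hij =>
      Fin.ext (Nat.cast_injective hij)
    refine ⟨ι × Fin (n + 1), inferInstance,
      fun kj lam => L kj.1 lam * (Lagrange.basis Finset.univ v kj.2).eval (lam a),
      fun kj => Function.update (γ kj.1) a (v kj.2), fun kj => ?_, fun kj i => ?_,
      fun p hpp lam => ?_⟩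
    · refine (hL kj.1).mul ?_
      simp_rw [← Polynomial.coe_aeval_eq_eval]
      exact (Polynomial.contDiff_aeval _ _).comp (contDiff_apply ℝ ℝ a)
    · by_cases h : i = a
      · subst h; simp [v]
      · simpa [h] using hγ kj.1 i
    · rw [hp p hpp lam, Fintype.sum_prod_type]
      refine Finset.sum_congr rfl fun k _ => ?_
      obtain ⟨P, hP, hPe⟩ := hpp (T.piecewise (γ k) lam) a
      have h0 : p (T.piecewise (γ k) lam) = P.eval (lam a) := by
        rw [← hPe]
        congr 1
        rw [eq_comm, Function.update_eq_self_iff, Finset.piecewise_eq_of_notMem _ _ _ ha]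
      have h1 := Lagrange.eq_interpolate (f := P) hv (by
        rw [Finset.card_univ, Fintype.card_fin]
        exact (degree_le_of_natDegree_le hP).trans_lt (by exact_mod_cast Nat.lt_succ_self n))
      have h2 := congrArg (eval (lam a)) h1
      rw [Lagrange.interpolate_apply, eval_finsetSum] at h2
      rw [h0, h2, Finset.mul_sum]
      refine Finset.sum_congr rfl fun j _ => ?_
      rw [eval_mul, eval_C, ← hPe]
      have h3 : Function.update (T.piecewise (γ k) lam) a (v j)
          = (insert a T).piecewise (Function.update (γ k) a (v j)) lam := by
        ext i
        by_cases h : i = a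
        · subst h; simp
        · by_cases hi : i ∈ T <;> simp [Finset.piecewise, h, hi]
      rw [h3]
      ring

open Polynomial in
theorem LinearMap.exists_polynomial_det_add_smul {E : Type*} [AddCommGroup E] [Module ℝ E]
    [FiniteDimensional ℝ E] (M N : E →ₗ[ℝ] E) :
    ∃ P : ℝ[X], P.natDegree ≤ Module.finrank ℝ E ∧ ∀ t : ℝ, LinearMap.det (M + t • N) = P.eval t := by
  let b := Module.finBasis ℝ E
  refine ⟨_, (natDegree_det_X_add_C_le (LinearMap.toMatrix b b N)
    (LinearMap.toMatrix b b M)).trans_eq (Fintype.card_fin _), fun t => ?_⟩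
  rw [← LinearMap.det_toMatrix b, ← coe_evalRingHom, RingHom.map_det]
  congr 1
  ext i j
  simp [add_comm, mul_comm t]

theorem exists_det_interpolation (σ : Type) [Fintype σ] (E : Type*) [NormedAddCommGroup E]
    [NormedSpace ℝ E] [FiniteDimensional ℝ E] :
    ∃ (ι : Type) (_ : Fintype ι) (L : ι → (σ → ℝ) → ℝ) (γ : ι → σ → ℝ),
      (∀ k, ContDiff ℝ ∞ (L k)) ∧ (∀ k i, 0 ≤ γ k i) ∧
      ∀ (M : E →L[ℝ] E) (N : σ → E →L[ℝ] E) (lam : σ → ℝ),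
        (M + ∑ i, lam i • N i).det = ∑ k, L k lam * (M + ∑ i, γ k i • N i).det := by
  classical
  obtain ⟨ι, _, L, γ, hL, hγ, hp⟩ :=
    exists_interpolation (σ := σ) (Module.finrank ℝ E) Finset.univ
  refine ⟨ι, inferInstance, L, γ, hL, hγ, fun M N lam => ?_⟩
  simpa using hp (fun lam => (M + ∑ i, lam i • N i).det) (fun lam i => by
    obtain ⟨P, hP, hPe⟩ := LinearMap.exists_polynomial_det_add_smul
      ((M + ∑ j ∈ Finset.univ.erase i, lam j • N j : E →L[ℝ] E) : E →ₗ[ℝ] E) (N i : E →ₗ[ℝ] E)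
    refine ⟨P, hP, fun t => ?_⟩
    rw [← hPe, ContinuousLinearMap.det]
    congr 1
    rw [← Finset.add_sum_erase _ _ (Finset.mem_univ i), Function.update_self,
      Finset.sum_congr rfl fun j hj => by rw [Function.update_of_ne (Finset.ne_of_mem_erase hj)]]
    push_cast
    abel) lam

end Interpolation

section UniformBound

variable {E : Type*} [NormedAddCommGroup E] [InnerProductSpace ℝ E]

theorem IsPotential.add_sum_smul {ι : Type*} [Fintype ι] {C : Set E} {u : E → ℝ} {G : E → E}
    {A : ι → Set E} {w : ι → E → ℝ} {g : ι → E → E} (h : IsPotential C u G)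
    (hA : ∀ i, IsPotential (A i) (w i) (g i)) {lam : ι → ℝ} (hl : ∀ i, 0 ≤ lam i) :
    IsPotential (C + ∑ i, lam i • A i) (u + ∑ i, lam i • w i) (G + ∑ i, lam i • g i) :=
  h.add (IsPotential.sum Finset.univ fun i _ => (hA i).smul (hl i))

theorem IsPotential.inner_add_sub_pos {C' : Set E} {u' : E → ℝ} {G G' : E → E}
    (hG : ∀ x y, x ≠ y → 0 < inner ℝ (G x - G y) (x - y)) (h' : IsPotential C' u' G') {x y : E}
    (hxy : x ≠ y) : 0 < inner ℝ ((G + G') x - (G + G') y) (x - y) := by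
  have : (G + G') x - (G + G') y = (G x - G y) + (G' x - G' y) := by
    simp only [Pi.add_apply]; abel
  rw [this, inner_add_left]
  exact add_pos_of_pos_of_nonneg (hG x y hxy) (h'.mono x y)

variable [FiniteDimensional ℝ E] [MeasurableSpace E] [BorelSpace E]
  (μ : Measure E) [μ.IsAddHaarMeasure] {s : ℕ}

theorem exists_taylorBound_of_isPotential {f : E → ℂ} (hf : ContDiff ℝ ∞ f)
    {A : Fin s → Set E} (hAc : ∀ i, IsCompact (A i)) (hAv : ∀ i, Convex ℝ (A i))
    {w : Fin s → E → ℝ} {g : Fin s → E → E}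
    (hA : ∀ i, IsPotential (A i) (w i) (g i)) (l : List (Fin s)) (R : ℝ) :
    ∃ c, ∀ (K : Set E) (u : E → ℝ) (G : E → E), IsCompact K → Convex ℝ K →
      K ⊆ Metric.closedBall 0 R → IsPotential K u G →
      (∀ x y, x ≠ y → 0 < inner ℝ (G x - G y) (x - y)) →
      TaylorBound c l fun lam => ∫ y in K + ∑ i, lam i • A i, f y ∂μ := by
  obtain ⟨ι, _, L, γ, hL, hγ, hdet⟩ := exists_det_interpolation (Fin s) E
  set Q : Set (E × (Fin s → E)) := Metric.closedBall (0 : E) R ×ˢ univ.pi A with hQ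
  have hQc : IsCompact Q := (isCompact_closedBall 0 R).prod (isCompact_univ_pi hAc)
  let H : ι → (E × (Fin s → E)) × (Fin s → ℝ) → ℂ := fun k p =>
    L k p.2 • f (p.1.1 + ∑ i, p.2 i • p.1.2 i)
  have hH : ∀ k, ContDiff ℝ ∞ (H k) := fun k => by
    refine ((hL k).comp contDiff_snd).smul (hf.comp ?_)
    fun_prop
  choose c hc using fun k => TaylorBound.of_contDiff hQc l (hH k)
  have hSc : ∀ lam : Fin s → ℝ, IsCompact (∑ i, lam i • A i) := fun lam =>
    Finset.sum_induction _ IsCompact (fun _ _ => IsCompact.add) isCompact_singleton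
      fun i _ => (hAc i).smul (lam i)
  have hSv : ∀ lam : Fin s → ℝ, Convex ℝ (∑ i, lam i • A i) := fun lam =>
    Finset.sum_induction _ (Convex ℝ) (fun _ _ => Convex.add) (convex_singleton 0)
      fun i _ => (hAv i).smul (lam i)
  refine ⟨∑ k, μ.real (Metric.closedBall 0 R + ∑ i, γ k i • A i) * |c k|,
    fun K u G hK hKv hKR hG hinj => ?_⟩
  have hfd : ∀ (lam : Fin s → ℝ) x, fderiv ℝ (G + ∑ i, lam i • g i) x
      = fderiv ℝ G x + ∑ i, lam i • fderiv ℝ (g i) x := fun lam x => by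
    have h1 : HasFDerivAt G (fderiv ℝ G x) x :=
      (hG.contDiff.differentiable (by simp) x).hasFDerivAt
    have h2 : ∀ i, HasFDerivAt (g i) (fderiv ℝ (g i) x) x := fun i =>
      ((hA i).contDiff.differentiable (by simp) x).hasFDerivAt
    exact (h1.add (HasFDerivAt.sum fun i _ => (h2 i).const_smul (lam i))).fderiv
  have hchg : ∀ {F : Type} [NormedAddCommGroup F] [NormedSpace ℝ F] {lam : Fin s → ℝ},
      (∀ i, 0 ≤ lam i) → ∀ {φ : E → F}, Continuous φ →
      Integrable (fun x => (fderiv ℝ G x + ∑ i, lam i • fderiv ℝ (g i) x).det •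
        φ (G x + ∑ i, lam i • g i x)) μ ∧
      ∫ y in K + ∑ i, lam i • A i, φ y ∂μ
        = ∫ x, (fderiv ℝ G x + ∑ i, lam i • fderiv ℝ (g i) x).det •
            φ (G x + ∑ i, lam i • g i x) ∂μ := by
    intro F _ _ lam hl φ hφ
    have hP := hG.add_sum_smul hA hl
    have := hP.setIntegral_eq μ (hKv.add (hSv lam))
      (fun x y hxy => IsPotential.inner_add_sub_pos hinj
        (IsPotential.sum Finset.univ fun i _ => (hA i).smul (hl i)) hxy)
      (hφ.continuousOn.integrableOn_compact (hK.add (hSc lam)))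
    simpa only [hfd, Pi.add_apply, Finset.sum_apply, Pi.smul_apply] using this
  set D : ι → E → ℝ := fun k x => (fderiv ℝ G x + ∑ i, γ k i • fderiv ℝ (g i) x).det with hD
  have hD0 : ∀ k x, 0 ≤ D k x := fun k x => by
    have := (hG.add_sum_smul hA (hγ k)).det_fderiv_nonneg x
    rwa [hfd] at this
  have hDi : ∀ k, Integrable (D k) μ ∧
      ∫ x, D k x ∂μ ≤ μ.real (Metric.closedBall 0 R + ∑ i, γ k i • A i) := by
    intro k
    have h1 := hchg (hγ k) (φ := fun _ => (1 : ℝ)) continuous_const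
    simp only [smul_eq_mul, mul_one, integral_const, measureReal_restrict_apply_univ] at h1
    refine ⟨h1.1, h1.2.symm.trans_le (measureReal_mono (add_subset_add_right hKR) ?_)⟩
    exact ((isCompact_closedBall 0 R).add (hSc (γ k))).measure_ne_top
  have hmem : ∀ x, (G x, fun i => g i x) ∈ Q := fun x =>
    ⟨hKR (hG.mem x), fun i _ => (hA i).mem x⟩
  have hint : ∀ k lam, Integrable (fun x => D k x • H k ((G x, fun i => g i x), lam)) μ := by
    intro k lam
    have hcts : Continuous fun v : E × (Fin s → E) => H k (v, lam) :=
      (hH k).continuous.comp (by fun_prop)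
    obtain ⟨B, hB⟩ := hQc.exists_bound_of_continuousOn hcts.continuousOn
    have hcx : Continuous fun x => H k ((G x, fun i => g i x), lam) :=
      hcts.comp (hG.contDiff.continuous.prodMk
        (continuous_pi fun i => (hA i).contDiff.continuous))
    refine ((hDi k).1.mul_const B).mono'
      ((hDi k).1.aestronglyMeasurable.smul hcx.aestronglyMeasurable) (ae_of_all _ fun x => ?_)
    rw [norm_smul, Real.norm_of_nonneg (hD0 k x)]
    exact mul_le_mul_of_nonneg_left (hB _ (hmem x)) (hD0 k x)
  have hbound : ∀ k, TaylorBound (μ.real (Metric.closedBall 0 R + ∑ i, γ k i • A i) * |c k|) l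
      fun lam => ∫ x, D k x • H k ((G x, fun i => g i x), lam) ∂μ := by
    intro k
    refine (TaylorBound.integral ((hDi k).1.mul_const |c k|)
      (k := fun x lam => D k x • H k ((G x, fun i => g i x), lam)) (fun x => ?_)
      fun lam _ => hint k lam).mono ?_
    · have := ((hc k _ (hmem x)).mono (le_abs_self _)).smul (D k x)
      rwa [abs_of_nonneg (hD0 k x)] at this
    · rw [integral_mul_const]
      exact mul_le_mul_of_nonneg_right (hDi k).2 (abs_nonneg _)
  refine (TaylorBound.sum Finset.univ fun k _ => hbound k).congr fun lam hl => ?_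
  have hl0 : ∀ i, 0 ≤ lam i := fun i => (hl i (mem_univ i)).1
  rw [Finset.sum_apply, ← integral_finsetSum _ fun k _ => hint k lam, (hchg hl0 hf.continuous).2]
  refine integral_congr_ae (ae_of_all _ fun x => ?_)
  simp only [hdet _ _ lam, Finset.sum_smul, H, smul_smul, hD, mul_comm]

theorem ConvexBody.exists_taylorBound {f : E → ℂ} (hf : ContDiff ℝ ∞ f)
    (A : Fin s → ConvexBody E) (l : List (Fin s)) (R : ℝ) :
    ∃ c, ∀ K : ConvexBody E, (K : Set E) ⊆ Metric.closedBall 0 R →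
      TaylorBound c l fun lam =>
        ∫ y in ((K + ∑ i, lam i • A i : ConvexBody E) : Set E), f y ∂μ := by
  choose w g hA using fun i => (A i).exists_isPotential μ
  obtain ⟨c, hc⟩ := exists_taylorBound_of_isPotential μ hf (fun i => (A i).isCompact)
    (fun i => (A i).convex) hA l (R + 1)
  refine ⟨c, fun K hKR => ?_⟩
  let B : ConvexBody E := ⟨Metric.closedBall 0 1, convex_closedBall 0 1, isCompact_closedBall 0 1,
    ⟨0, Metric.mem_closedBall_self zero_le_one⟩⟩
  let ε : ℕ → ℝ := fun m => 1 / ((m : ℝ) + 1)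
  have hε : ∀ m, 0 < ε m := fun m => by positivity
  have hε1 : ∀ m, ε m ≤ 1 := fun m => by
    rw [div_le_one (by positivity)]
    linarith [Nat.cast_nonneg (α := ℝ) m]
  have hεB : ∀ m, ∀ b ∈ ((ε m • B : ConvexBody E) : Set E), ‖b‖ ≤ ε m := by
    intro m b hb
    rw [ConvexBody.coe_smul] at hb
    obtain ⟨b, hb, rfl⟩ := hb
    have : ‖b‖ ≤ 1 := mem_closedBall_zero_iff.1 hb
    simp only [norm_smul, Real.norm_of_nonneg (hε m).le]
    exact mul_le_of_le_one_right (hε m).le this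
  have hlim : Tendsto (fun m => K + ε m • B) atTop (𝓝 K) := by
    rw [tendsto_iff_dist_tendsto_zero]
    refine squeeze_zero (fun _ => dist_nonneg) (fun m => ?_) tendsto_one_div_add_atTop_nhds_zero_nat
    rw [← ConvexBody.hausdorffDist_coe, ConvexBody.coe_add]
    refine Metric.hausdorffDist_le_of_mem_dist (hε m).le ?_ fun x hx => ⟨x, ⟨x, hx, 0, ?_, ?_⟩, ?_⟩
    · rintro _ ⟨x, hx, b, hb, rfl⟩
      refine ⟨x, hx, ?_⟩
      rw [dist_eq_norm, add_sub_cancel_left]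
      exact hεB m b hb
    · rw [ConvexBody.coe_smul]
      exact ⟨0, Metric.mem_closedBall_self zero_le_one, smul_zero _⟩
    · exact add_zero x
    · exact (dist_self _).trans_le (hε m).le
  refine (TaylorBound.tendsto (L := atTop)
    (F := fun (m : ℕ) lam => ∫ y in ((K + ε m • B + ∑ i, lam i • A i : ConvexBody E) : Set E),
      f y ∂μ) (Eventually.of_forall fun m => ?_) fun lam _ => ?_).1
  · obtain ⟨u, G, hG⟩ := K.exists_isPotential μ
    have hB := (isPotential_ballGradient (E := E)).smul (hε m).le
    have hsub : ((K + ε m • B : ConvexBody E) : Set E) ⊆ Metric.closedBall 0 (R + 1) := by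
      rw [ConvexBody.coe_add]
      rintro _ ⟨x, hx, b, hb, rfl⟩
      rw [mem_closedBall_zero_iff]
      exact (norm_add_le x b).trans (add_le_add (mem_closedBall_zero_iff.1 (hKR hx))
        ((hεB m b hb).trans (hε1 m)))
    have hP : IsPotential ((K + ε m • B : ConvexBody E) : Set E)
        ((ε m • fun x => √(1 + ‖x‖ ^ 2)) + u) (ε m • ballGradient + G) := by
      rw [add_comm K, ConvexBody.coe_add, ConvexBody.coe_smul]
      exact hB.add hG
    have := hc _ _ _ (K + ε m • B).isCompact (K + ε m • B).convex hsub hP fun x y hxy =>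
      hG.inner_add_sub_pos (fun x y hxy => by
        rw [Pi.smul_apply, Pi.smul_apply, ← smul_sub, real_inner_smul_left]
        exact mul_pos (hε m) (inner_ballGradient_sub_pos hxy)) hxy
    simpa only [ConvexBody.coe_add, ConvexBody.coe_sum, ConvexBody.coe_smul] using this
  · exact ((ConvexBody.continuous_setIntegral μ hf.continuous).comp
      (ConvexBody.continuous_add_right _)).continuousAt.tendsto.comp hlim

end UniformBound

/-- `K ↦ ∂^s/∂λ |₀ ∫_{K + Σ λᵢAᵢ} f` is a continuous valuation on `𝒦(ℝⁿ)`. -/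
theorem mixed_derivative_is_continuous_valuation {n : ℕ} (hn : 1 ≤ n)
    (s : ℕ) (hs : s ≤ n) (f : Euc n → ℂ) (hf : ContDiff ℝ ∞ f)
    (A : Fin s → ConvexBody (Euc n)) :
    IsValuation (fun K : ConvexBody (Euc n) => mixedPartialAtZero (fun lam : Fin s → ℝ =>
        ∫ y in ((K : Set (Euc n)) + ∑ i, lam i • (A i : Set (Euc n))), f y)) ∧
    Continuous (fun K : ConvexBody (Euc n) => mixedPartialAtZero (fun lam : Fin s → ℝ =>
        ∫ y in ((K : Set (Euc n)) + ∑ i, lam i • (A i : Set (Euc n))), f y)) := by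
  have hcoe : ∀ K : ConvexBody (Euc n),
      (fun lam : Fin s → ℝ => ∫ y in ((K : Set (Euc n)) + ∑ i, lam i • (A i : Set (Euc n))), f y)
        = fun lam => ∫ y in ((K + ∑ i, lam i • A i : ConvexBody (Euc n)) : Set (Euc n)), f y := by
    intro K
    simp only [ConvexBody.coe_add, ConvexBody.coe_sum, ConvexBody.coe_smul]
  simp only [hcoe]
  have h0 : (0 : Fin s → ℝ) ∈ unitCube s := fun i _ => ⟨le_rfl, zero_lt_one⟩
  have hbound := ConvexBody.exists_taylorBound (volume : Measure (Euc n)) hf A (List.finRange s)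
  refine ⟨fun K L M N hM hN => ?_, continuous_iff_continuousAt.2 fun K => ?_⟩
  · have hT : ∀ K : ConvexBody (Euc n), ∃ c, TaylorBound c (List.finRange s) fun lam =>
        ∫ y in ((K + ∑ i, lam i • A i : ConvexBody (Euc n)) : Set (Euc n)), f y := fun K => by
      obtain ⟨R, hR⟩ := K.isBounded.subset_closedBall 0
      obtain ⟨c, hc⟩ := hbound R
      exact ⟨c, hc K hR⟩
    obtain ⟨_, hTK⟩ := hT K
    obtain ⟨_, hTL⟩ := hT L
    obtain ⟨_, hTM⟩ := hT M
    obtain ⟨_, hTN⟩ := hT N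
    have h1 := (hTM.add hTN).2 h0
    have h2 := (hTK.add hTL).2 h0
    simp only [mixedPartialAtZero]
    rw [Pi.add_apply] at h1 h2
    rw [← h1, ← h2]
    exact foldl_pderivOrth_congr _ (fun lam _ =>
      ConvexBody.setIntegral_union_add_inter volume hf.continuous hM hN _) h0
  · obtain ⟨R, hR⟩ := K.isBounded.subset_closedBall 0
    obtain ⟨c, hc⟩ := hbound (R + 1)
    refine (TaylorBound.tendsto ((K.eventually_subset_closedBall hR).mono hc) fun lam _ => ?_).2 0 h0
    exact ((ConvexBody.continuous_setIntegral volume hf.continuous).comp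
      (ConvexBody.continuous_add_right _)).continuousAt.tendsto
end
end

section
/- Let m, q ≥ 1, let f : ℝ^m → ℂ and g : ℝ^q → ℂ be C^∞, let A_1, …, A_k be convex bodies in ℝ^m, let B_1, …, B_p be convex bodies in ℝ^q, and let K be a convex body in ℝ^m × ℝ^q. For θ ∈ ℝ_{≥0}^p and y ∈ ℝ^q, define the slice S_θ(y) := {x ∈ ℝ^m : (x, y) ∈ K + θ_1({0} × B_1) + ⋯ + θ_p({0} × B_p)}, and set h_θ(y) := ∂^k/∂λ_1⋯∂λ_k |_{λ=0} ∫_{S_θ(y) + λ_1 A_1 + ⋯ + λ_k A_k} f(x) dx when S_θ(y) is nonempty, and h_θ(y) := 0 otherwise. Then ∂^k/∂λ_1⋯∂λ_k ∂^p/∂θ_1⋯∂θ_p |_{λ=0, θ=0} ∬_{K + Σ_i λ_i (A_i × {0}) + Σ_j θ_j ({0} × B_j)} f(x) g(y) dx dy = ∂^p/∂θ_1⋯∂θ_p |_{θ=0} ∫_{ℝ^q} g(y) · h_θ(y) dy, where all mixed partial derivatives at the origin of the respective orthants exist and are one-sided. -/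
open scoped Pointwise ContDiff
open MeasureTheory Set Filter

noncomputable section

/-- The slice `S_θ(y) = {x : (x,y) ∈ K + Σ_j θ_j ({0} × B_j)}`. -/
def sliceSet {m q p : ℕ} (K : ConvexBody (Euc m × Euc q)) (B : Fin p → ConvexBody (Euc q))
    (th : Fin p → ℝ) (y : Euc q) : Set (Euc m) :=
  {x : Euc m | (x, y) ∈ (K : Set (Euc m × Euc q))
      + ∑ j, th j • (({0} : Set (Euc m)) ×ˢ (B j : Set (Euc q)))}

open Classical in
/-- `h_θ(y) = ∂^k/∂λ |₀ ∫_{S_θ(y) + Σ λᵢAᵢ} f` when the slice `S_θ(y)` is nonempty, `0`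
otherwise. -/
def sliceIntegral {m q k p : ℕ} (f : Euc m → ℂ) (A : Fin k → ConvexBody (Euc m))
    (K : ConvexBody (Euc m × Euc q)) (B : Fin p → ConvexBody (Euc q))
    (th : Fin p → ℝ) (y : Euc q) : ℂ :=
  if (sliceSet K B th y).Nonempty then
    mixedPartialAtZero (fun lam : Fin k → ℝ =>
      ∫ x in (sliceSet K B th y + ∑ i, lam i • (A i : Set (Euc m))), f x)
  else 0

section ParametricIntegral

open scoped Topology

variable {P C J Y : Type*} [NormedAddCommGroup P] [NormedAddCommGroup C]

section Bounds

variable [MeasurableSpace C]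

/-- A family of measures with masses at most `M`, carried by the ball of radius `R`. -/
def BoundedMeasures (M : NNReal) (R : ℝ) (ν : J → Measure C) : Prop :=
  ∀ j, ν j univ ≤ M ∧ ∀ᵐ c ∂ν j, ‖c‖ ≤ R

lemma BoundedMeasures.isFiniteMeasure {M : NNReal} {R : ℝ} {ν : J → Measure C}
    (h : BoundedMeasures M R ν) (j : J) : IsFiniteMeasure (ν j) :=
  ⟨(h j).1.trans_lt ENNReal.coe_lt_top⟩

variable [Fintype J]

/-- The sum over `j` of the integrals of `Ψ j (p, ·)` against `ν j`. -/
def paramIntegral (ν : J → Measure C) (Ψ : J → P × C → ℂ) (p : P) : ℂ :=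
  ∑ j, ∫ c, Ψ j (p, c) ∂ν j

lemma norm_paramIntegral_le [ProperSpace C] (M : NNReal) (R : ℝ)
    {Ψ : J → P × C → ℂ} (h : ∀ j, Continuous (Ψ j))
    {Q : Set P} (hQ : IsCompact Q) :
    ∃ b : ℝ, ∀ ν : J → Measure C, BoundedMeasures M R ν → ∀ p ∈ Q, ‖paramIntegral ν Ψ p‖ ≤ b := by
  choose b hb using fun j =>
    (hQ.prod (isCompact_closedBall (0 : C) R)).exists_bound_of_continuousOn (h j).continuousOn
  refine ⟨∑ j, |b j| * M, fun ν hν p hp => ?_⟩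
  refine (norm_sum_le _ _).trans (Finset.sum_le_sum fun j _ => ?_)
  have := hν.isFiniteMeasure j
  have h1 : ∀ᵐ c ∂ν j, ‖Ψ j (p, c)‖ ≤ |b j| := by
    filter_upwards [(hν j).2] with c hc
    exact (hb j (p, c) ⟨hp, by simpa using hc⟩).trans (le_abs_self _)
  refine (norm_integral_le_of_norm_le_const h1).trans ?_
  gcongr
  exact ENNReal.toReal_le_coe_of_le_coe (hν j).1

end Bounds

variable [NormedSpace ℝ P] [NormedSpace ℝ C]

/-- The partial derivative, in the direction `v` of the first factor, of a family of functions. -/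
def partialFst (v : P) (Ψ : J → P × C → ℂ) : J → P × C → ℂ :=
  fun j z => fderiv ℝ (Ψ j) z (v, 0)

lemma contDiff_partialFst {Ψ : J → P × C → ℂ} (h : ∀ j, ContDiff ℝ ∞ (Ψ j)) (v : P) (j : J) :
    ContDiff ℝ ∞ (partialFst v Ψ j) :=
  ((h j).fderiv_right (m := ∞) (by norm_cast)).clm_apply contDiff_const

lemma partialFst_comm {Ψ : J → P × C → ℂ} (h : ∀ j, ContDiff ℝ ∞ (Ψ j)) (v w : P) :
    partialFst v (partialFst w Ψ) = partialFst w (partialFst v Ψ) := by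
  have key : ∀ (v w : P) j z, partialFst v (partialFst w Ψ) j z =
      fderiv ℝ (fderiv ℝ (Ψ j)) z (v, 0) (w, 0) := by
    intro v w j z
    have hd : DifferentiableAt ℝ (fderiv ℝ (Ψ j)) z :=
      (((h j).fderiv_right (m := ∞) (by norm_cast)).differentiable (by simp)) z
    change fderiv ℝ (fun z => fderiv ℝ (Ψ j) z (w, 0)) z (v, 0) = _
    rw [fderiv_clm_apply hd (differentiableAt_const _)]
    simp
  funext j z
  rw [key, key]
  exact ((h j).contDiffAt.isSymmSndFDerivAt (by
    simpa using ENat.LEInfty.out)) _ _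

/-- The iterated partial derivative along the directions `v i`, for `i` running through a list. -/
def partialList {I : Type*} (v : I → P) (L : List I) (Ψ : J → P × C → ℂ) : J → P × C → ℂ :=
  L.foldl (fun Φ i => partialFst (v i) Φ) Ψ

lemma contDiff_partialList {I : Type*} (v : I → P) (L : List I) {Ψ : J → P × C → ℂ}
    (h : ∀ j, ContDiff ℝ ∞ (Ψ j)) : ∀ j, ContDiff ℝ ∞ (partialList v L Ψ j) := by
  induction L generalizing Ψ with
  | nil => exact h
  | cons i L ih => exact ih (contDiff_partialFst h (v i))

lemma partialFst_partialList {I : Type*} (v : I → P) (w : P) (L : List I) {Ψ : J → P × C → ℂ}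
    (h : ∀ j, ContDiff ℝ ∞ (Ψ j)) :
    partialFst w (partialList v L Ψ) = partialList v L (partialFst w Ψ) := by
  induction L generalizing Ψ with
  | nil => rfl
  | cons i L ih =>
    change partialFst w (partialList v L (partialFst (v i) Ψ)) =
      partialList v L (partialFst (v i) (partialFst w Ψ))
    rw [ih (contDiff_partialFst h (v i)), partialFst_comm h]

lemma partialList_comm {I I' : Type*} (v : I → P) (w : I' → P) (L : List I) (L' : List I')
    {Ψ : J → P × C → ℂ} (h : ∀ j, ContDiff ℝ ∞ (Ψ j)) :
    partialList v L (partialList w L' Ψ) = partialList w L' (partialList v L Ψ) := by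
  induction L generalizing Ψ with
  | nil => rfl
  | cons i L ih =>
    change partialList v L (partialFst (v i) (partialList w L' Ψ)) =
      partialList w L' (partialList v L (partialFst (v i) Ψ))
    rw [partialFst_partialList w (v i) L' h, ih (contDiff_partialFst h (v i))]

variable [Fintype J] [MeasurableSpace C] [FiniteDimensional ℝ C] [BorelSpace C]

lemma hasDerivAt_paramIntegral {M : NNReal} {R : ℝ} {ν : J → Measure C}
    (hν : BoundedMeasures M R ν) {Ψ : J → P × C → ℂ} (h : ∀ j, ContDiff ℝ ∞ (Ψ j)) (p v : P)
    (t : ℝ) :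
    HasDerivAt (fun s : ℝ => paramIntegral ν Ψ (p + s • v))
      (paramIntegral ν (partialFst v Ψ) (p + t • v)) t := by
  have : ProperSpace C := FiniteDimensional.proper ℝ C
  have : SecondCountableTopology C := secondCountable_of_proper
  unfold paramIntegral
  refine HasDerivAt.fun_sum fun j _ => ?_
  have := hν.isFiniteMeasure j
  have hc : Continuous fun s : ℝ => p + s • v := by fun_prop
  obtain ⟨b, hb⟩ := (((isCompact_closedBall t 1).image hc).prod
    (isCompact_closedBall (0 : C) R)).exists_bound_of_continuousOn
    (contDiff_partialFst h v j).continuous.continuousOn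
  obtain ⟨b', hb'⟩ := (((isCompact_closedBall t 1).image hc).prod
    (isCompact_closedBall (0 : C) R)).exists_bound_of_continuousOn (h j).continuous.continuousOn
  have hmeas : ∀ s : ℝ, AEStronglyMeasurable (fun c => Ψ j (p + s • v, c)) (ν j) := fun s =>
    ((h j).continuous.comp (by fun_prop : Continuous fun c : C => (p + s • v, c)))
      |>.aestronglyMeasurable
  refine (hasDerivAt_integral_of_dominated_loc_of_deriv_le (bound := fun _ => b)
    (F' := fun s c => partialFst v Ψ j (p + s • v, c))
    (Metric.closedBall_mem_nhds t one_pos) (Eventually.of_forall hmeas) ?_ ?_ ?_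
    (integrable_const b) ?_).2
  · refine Integrable.of_bound (hmeas t) b' ?_
    filter_upwards [(hν j).2] with c hc
    exact hb' _ ⟨mem_image_of_mem _ (Metric.mem_closedBall_self zero_le_one), by simpa using hc⟩
  · exact ((contDiff_partialFst h v j).continuous.comp
      (by fun_prop : Continuous fun c : C => (p + t • v, c))).aestronglyMeasurable
  · filter_upwards [(hν j).2] with c hc s hs
    exact hb _ ⟨mem_image_of_mem _ hs, by simpa using hc⟩
  · refine Eventually.of_forall fun c s _ => ?_
    have h1 : HasDerivAt (fun s : ℝ => (p + s • v, c)) (v, (0 : C)) s := by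
      refine HasDerivAt.prodMk ?_ (hasDerivAt_const _ _)
      simpa using ((hasDerivAt_id s).smul_const v).const_add p
    exact (((h j).differentiable (by simp) _).hasFDerivAt).comp_hasDerivAt s h1

variable [MeasurableSpace Y] {μ : Measure Y}

lemma hasDerivWithinAt_integral_paramIntegral {M : NNReal} {R : ℝ} {ν : Y → J → Measure C}
    (hν : ∀ y, BoundedMeasures M R (ν y)) {Ψ : J → P × C → ℂ} (h : ∀ j, ContDiff ℝ ∞ (Ψ j))
    {b : Y → ℂ} (hb : Integrable b μ) (p v : P)
    (hm : ∀ t : ℝ, 0 ≤ t →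
      AEStronglyMeasurable (fun y => b y * paramIntegral (ν y) Ψ (p + t • v)) μ)
    {t : ℝ} (ht : 0 ≤ t) :
    HasDerivWithinAt (fun s : ℝ => ∫ y, b y * paramIntegral (ν y) Ψ (p + s • v) ∂μ)
      (∫ y, b y * paramIntegral (ν y) (partialFst v Ψ) (p + t • v) ∂μ) (Ici 0) t ∧
    AEStronglyMeasurable
      (fun y => b y * paramIntegral (ν y) (partialFst v Ψ) (p + t • v)) μ := by
  have : ProperSpace C := FiniteDimensional.proper ℝ C
  have hc : Continuous fun s : ℝ => p + s • v := by fun_prop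
  have hQ : IsCompact ((fun s : ℝ => p + s • v) '' Icc 0 (t + 1)) := isCompact_Icc.image hc
  obtain ⟨K, hK⟩ := norm_paramIntegral_le M R (fun j => (h j).continuous) hQ
  obtain ⟨K', hK'⟩ := norm_paramIntegral_le M R (fun j => (contDiff_partialFst h v j).continuous) hQ
  have h_int : ∀ s ∈ Icc 0 (t + 1),
      Integrable (fun y => b y * paramIntegral (ν y) Ψ (p + s • v)) μ := by
    intro s hs
    refine (hb.norm.mul_const K).mono' (hm s hs.1) (Eventually.of_forall fun y => ?_)
    rw [norm_mul]
    gcongr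
    exact hK _ (hν y) _ (mem_image_of_mem _ hs)
  have hder : ∀ y s, HasDerivAt (fun s : ℝ => b y * paramIntegral (ν y) Ψ (p + s • v))
      (b y * paramIntegral (ν y) (partialFst v Ψ) (p + s • v)) s := fun y s =>
    (hasDerivAt_paramIntegral (hν y) h p v s).const_mul (b y)
  have hmem : Icc 0 (t + 1) ∈ 𝓝[Ici 0 \ {t}] t := by
    filter_upwards [self_mem_nhdsWithin,
      nhdsWithin_le_nhds (Iio_mem_nhds (by linarith : t < t + 1))] with s hs hs'
    exact ⟨hs.1, le_of_lt hs'⟩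
  have hslope : ∀ s ∈ Icc 0 (t + 1), AEStronglyMeasurable
      (fun y => slope (fun s : ℝ => b y * paramIntegral (ν y) Ψ (p + s • v)) t s) μ := by
    intro s hs
    simp only [slope, vsub_eq_sub]
    exact ((hm s hs.1).sub (hm t ht)).const_smul _
  have hlim : ∀ y, Tendsto (slope (fun s : ℝ => b y * paramIntegral (ν y) Ψ (p + s • v)) t)
      (𝓝[Ici 0 \ {t}] t) (𝓝 (b y * paramIntegral (ν y) (partialFst v Ψ) (p + t • v))) := fun y =>
    hasDerivWithinAt_iff_tendsto_slope.1 (hder y t).hasDerivWithinAt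
  constructor
  · rw [hasDerivWithinAt_iff_tendsto_slope]
    have heq : ∀ᶠ s in 𝓝[Ici 0 \ {t}] t,
        ∫ y, slope (fun s : ℝ => b y * paramIntegral (ν y) Ψ (p + s • v)) t s ∂μ =
        slope (fun s : ℝ => ∫ y, b y * paramIntegral (ν y) Ψ (p + s • v) ∂μ) t s := by
      filter_upwards [hmem] with s hs
      simp only [slope, vsub_eq_sub]
      rw [integral_smul, integral_sub (h_int s hs) (h_int t ⟨ht, by linarith⟩)]
    refine Tendsto.congr' heq ?_
    refine tendsto_integral_filter_of_dominated_convergence (fun y => ‖b y‖ * K') ?_ ?_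
      (hb.norm.mul_const K') (Eventually.of_forall hlim)
    · filter_upwards [hmem] with s hs using hslope s hs
    · filter_upwards [hmem, self_mem_nhdsWithin] with s hs hst
      refine Eventually.of_forall fun y => ?_
      have hle := Convex.norm_image_sub_le_of_norm_hasDerivWithin_le (C := ‖b y‖ * K')
        (fun s _ => (hder y s).hasDerivWithinAt) (fun s hs => by
          rw [norm_mul]
          gcongr
          exact hK' _ (hν y) _ (mem_image_of_mem _ hs)) (convex_Icc 0 (t + 1))
        (⟨ht, by linarith⟩ : t ∈ Icc 0 (t + 1)) hs
      have hpos : 0 < ‖s - t‖ := norm_pos_iff.2 (sub_ne_zero.2 hst.2)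
      rw [slope_def_module, norm_smul, norm_inv]
      rw [inv_mul_le_iff₀ hpos, mul_comm ‖s - t‖]
      exact hle
  · have hseq : Tendsto (fun n : ℕ => t + 1 / ((n : ℝ) + 1)) atTop (𝓝[Ici 0 \ {t}] t) := by
      refine tendsto_nhdsWithin_iff.2 ⟨?_, Eventually.of_forall fun n => ⟨?_, ?_⟩⟩
      · simpa using tendsto_one_div_add_atTop_nhds_zero_nat.const_add t
      · have : (0 : ℝ) < 1 / ((n : ℝ) + 1) := by positivity
        exact mem_Ici.2 (by linarith)
      · have : (0 : ℝ) < 1 / ((n : ℝ) + 1) := by positivity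
        simp only [mem_singleton_iff]
        linarith
    refine aestronglyMeasurable_of_tendsto_ae atTop (fun n : ℕ => hslope (t + 1 / ((n : ℝ) + 1)) ?_)
      (Eventually.of_forall fun y => (hlim y).comp hseq)
    have : (0 : ℝ) < 1 / ((n : ℝ) + 1) := by positivity
    refine ⟨by linarith, ?_⟩
    have : 1 / ((n : ℝ) + 1) ≤ 1 := by
      rw [div_le_one (by positivity)]
      linarith [(Nat.cast_nonneg n : (0 : ℝ) ≤ n)]
    linarith

lemma foldl_pderivOrth_integral {M : NNReal} {R : ℝ} {ν : Y → J → Measure C}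
    (hν : ∀ y, BoundedMeasures M R (ν y)) {b : Y → ℂ} (hb : Integrable b μ) {s : ℕ} (p : P)
    (v : Fin s → P) (L : List (Fin s)) {Ψ : J → P × C → ℂ} (h : ∀ j, ContDiff ℝ ∞ (Ψ j))
    {G : (Fin s → ℝ) → ℂ}
    (hG : ∀ l, 0 ≤ l → G l = ∫ y, b y * paramIntegral (ν y) Ψ (p + ∑ i, l i • v i) ∂μ)
    (hm : ∀ l : Fin s → ℝ, 0 ≤ l →
      AEStronglyMeasurable (fun y => b y * paramIntegral (ν y) Ψ (p + ∑ i, l i • v i)) μ) :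
    ∀ l, 0 ≤ l → L.foldl pderivOrth G l =
      ∫ y, b y * paramIntegral (ν y) (partialList v L Ψ) (p + ∑ i, l i • v i) ∂μ := by
  induction L generalizing Ψ G with
  | nil => exact hG
  | cons i L ih =>
    have hupd : ∀ (l : Fin s → ℝ) (t : ℝ), p + ∑ a, Function.update l i t a • v a =
        (p + ∑ a, Function.update l i 0 a • v a) + t • v i := by
      intro l t
      have : ∀ a, Function.update l i t a • v a =
          Function.update l i 0 a • v a + if a = i then t • v i else 0 := by
        intro a
        by_cases hai : a = i
        · subst hai; simp
        · simp [hai]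
      rw [Finset.sum_congr rfl fun a _ => this a, Finset.sum_add_distrib]
      simp [add_assoc]
    have hnn : ∀ l : Fin s → ℝ, 0 ≤ l → ∀ t : ℝ, 0 ≤ t → 0 ≤ Function.update l i t := by
      intro l hl t ht a
      by_cases hai : a = i
      · subst hai; simpa using ht
      · simpa [hai] using hl a
    have key : ∀ l : Fin s → ℝ, 0 ≤ l → _ := fun l hl =>
      hasDerivWithinAt_integral_paramIntegral hν h hb
        (p + ∑ a, Function.update l i 0 a • v a) (v i)
        (fun t ht => by rw [← hupd]; exact hm _ (hnn l hl t ht)) (hl i)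
    have hself : ∀ l : Fin s → ℝ,
        (p + ∑ a, Function.update l i 0 a • v a) + l i • v i = p + ∑ a, l a • v a := by
      intro l
      rw [← hupd, Function.update_eq_self]
    refine ih (contDiff_partialFst h (v i)) (G := pderivOrth G i) ?_ ?_
    · intro l hl
      have h1 := (key l hl).1
      rw [hself] at h1
      refine HasDerivWithinAt.derivWithin (h1.congr_of_mem ?_ (mem_Ici.2 (hl i)))
        (uniqueDiffOn_Ici 0 _ (mem_Ici.2 (hl i)))
      intro t ht
      rw [hG _ (hnn l hl t ht), hupd]
    · intro l hl
      have h2 := (key l hl).2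
      rwa [hself] at h2

lemma mixedPartialAtZero_integral {M : NNReal} {R : ℝ} {ν : Y → J → Measure C}
    (hν : ∀ y, BoundedMeasures M R (ν y)) {b : Y → ℂ} (hb : Integrable b μ) {s : ℕ} (p : P)
    (v : Fin s → P) {Ψ : J → P × C → ℂ} (h : ∀ j, ContDiff ℝ ∞ (Ψ j)) {G : (Fin s → ℝ) → ℂ}
    (hG : ∀ l, 0 ≤ l → G l = ∫ y, b y * paramIntegral (ν y) Ψ (p + ∑ i, l i • v i) ∂μ)
    (hm : ∀ l : Fin s → ℝ, 0 ≤ l →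
      AEStronglyMeasurable (fun y => b y * paramIntegral (ν y) Ψ (p + ∑ i, l i • v i)) μ) :
    mixedPartialAtZero G =
      ∫ y, b y * paramIntegral (ν y) (partialList v (List.finRange s) Ψ) p ∂μ := by
  have := foldl_pderivOrth_integral hν hb p v (List.finRange s) h hG hm 0 le_rfl
  simpa [mixedPartialAtZero] using this

lemma mixedPartialAtZero_paramIntegral {M : NNReal} {R : ℝ} {ν : J → Measure C}
    (hν : BoundedMeasures M R ν) {s : ℕ} (p : P) (v : Fin s → P) {Ψ : J → P × C → ℂ}
    (h : ∀ j, ContDiff ℝ ∞ (Ψ j)) {G : (Fin s → ℝ) → ℂ}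
    (hG : ∀ l, 0 ≤ l → G l = paramIntegral ν Ψ (p + ∑ i, l i • v i)) :
    mixedPartialAtZero G = paramIntegral ν (partialList v (List.finRange s) Ψ) p := by
  have := mixedPartialAtZero_integral (μ := Measure.dirac ()) (ν := fun _ : Unit => ν)
    (fun _ => hν) (b := fun _ => 1) (integrable_const 1) p v h (G := G)
    (by simpa using hG) (fun l _ => aestronglyMeasurable_const)
  simpa using this

end ParametricIntegral

section ConvexPotential

open scoped Topology

variable {E : Type*} [NormedAddCommGroup E] [InnerProductSpace ℝ E]

/-- `φ` is a convex function of at most the growth of the support function of `S`, whose gradient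
`T` is smooth and takes its values in `S`. -/
structure IsConvexPotential (S : Set E) (φ : E → ℝ) (T : E → E) : Prop where
  contDiff : ContDiff ℝ ∞ T
  hasFDerivAt : ∀ u, HasFDerivAt φ (innerSL ℝ (T u)) u
  le : ∀ u v, φ u + inner ℝ (T u) (v - u) ≤ φ v
  mem : ∀ u, T u ∈ S
  growth : ∃ c, ∀ a ∈ S, ∀ u, inner ℝ a u - c ≤ φ u

open scoped Classical in
lemma IsConvexPotential.sum {ι : Type*} [Fintype ι] {S : ι → Set E} {φ : ι → E → ℝ}
    {T : ι → E → E} (h : ∀ i, IsConvexPotential (S i) (φ i) (T i)) {l : ι → ℝ} (hl : 0 ≤ l) :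
    IsConvexPotential (∑ i, l i • S i) (fun u => ∑ i, l i * φ i u)
      (fun u => ∑ i, l i • T i u) where
  contDiff := ContDiff.sum fun i _ => contDiff_const.smul (h i).contDiff
  hasFDerivAt u := by
    have := HasFDerivAt.fun_sum (u := Finset.univ) fun i _ =>
      ((h i).hasFDerivAt u).const_mul (l i)
    refine this.congr_fderiv ?_
    ext w
    simp
  le u v := by
    rw [sum_inner, ← Finset.sum_add_distrib]
    refine Finset.sum_le_sum fun i _ => ?_
    rw [real_inner_smul_left, ← mul_add]
    exact mul_le_mul_of_nonneg_left ((h i).le u v) (hl i)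
  mem u := (Set.mem_fintype_sum _ _).2
    ⟨fun i => l i • T i u, fun i => Set.smul_mem_smul_set ((h i).mem u), rfl⟩
  growth := by
    choose c hc using fun i => (h i).growth
    refine ⟨∑ i, l i * c i, fun a ha u => ?_⟩
    obtain ⟨x, hx, rfl⟩ := (Set.mem_fintype_sum _ _).1 ha
    rw [sum_inner, ← Finset.sum_sub_distrib]
    refine Finset.sum_le_sum fun i _ => ?_
    obtain ⟨y, hy, hyx⟩ := hx i
    rw [← (show l i • y = x i from hyx), real_inner_smul_left, ← mul_sub]
    exact mul_le_mul_of_nonneg_left (hc i y hy u) (hl i)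

variable {S : Set E} {φ : E → ℝ} {T : E → E}

lemma IsConvexPotential.inner_sub_nonneg (h : IsConvexPotential S φ T) (u v : E) :
    0 ≤ inner ℝ (T u - T v) (u - v) := by
  have h1 := h.le u v
  have h2 := h.le v u
  rw [← neg_sub u v, inner_neg_right] at h1
  rw [inner_sub_left]
  linarith

lemma IsConvexPotential.differentiable (h : IsConvexPotential S φ T) : Differentiable ℝ T :=
  h.contDiff.differentiable (by simp)

lemma IsConvexPotential.hasDerivAt_line (h : IsConvexPotential S φ T) (u v : E) :
    HasDerivAt (fun t : ℝ => T (u + t • v)) (fderiv ℝ T u v) 0 := by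
  have h1 : HasDerivAt (fun t : ℝ => u + t • v) v 0 := by
    simpa using ((hasDerivAt_id (0 : ℝ)).smul_const v).const_add u
  have h2 := (h.differentiable (u + (0 : ℝ) • v)).hasFDerivAt.comp_hasDerivAt (0 : ℝ) h1
  rw [zero_smul, add_zero] at h2
  exact h2

lemma IsConvexPotential.inner_fderiv_nonneg (h : IsConvexPotential S φ T) (u v : E) :
    0 ≤ inner ℝ (fderiv ℝ T u v) v := by
  have h4 : HasDerivAt (fun t : ℝ => inner ℝ (T (u + t • v)) v) (inner ℝ (fderiv ℝ T u v) v) 0 := by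
    simpa using (h.hasDerivAt_line u v).inner ℝ (hasDerivAt_const (0 : ℝ) v)
  refine h4.nonneg_of_monotone fun s t hst => ?_
  rcases hst.eq_or_lt with rfl | hst
  · rfl
  have h5 := h.inner_sub_nonneg (u + t • v) (u + s • v)
  rw [add_sub_add_left_eq_sub, ← sub_smul, real_inner_smul_right, inner_sub_left] at h5
  simpa using nonneg_of_mul_nonneg_right h5 (sub_pos.2 hst)

lemma det_nonneg_of_inner_nonneg [FiniteDimensional ℝ E] (A : E →L[ℝ] E)
    (hA : ∀ v, 0 ≤ inner ℝ (A v) v) : 0 ≤ A.det := by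
  by_contra! hneg
  have hcont : Continuous fun t : ℝ => ((1 - t) • A + t • ContinuousLinearMap.id ℝ E).det :=
    ContinuousLinearMap.continuous_det.comp (by fun_prop)
  have h0 : (0 : ℝ) ∈ Icc ((((1 : ℝ) - 0) • A + (0 : ℝ) • ContinuousLinearMap.id ℝ E).det)
      ((((1 : ℝ) - 1) • A + (1 : ℝ) • ContinuousLinearMap.id ℝ E).det) := by
    constructor
    · simpa using hneg.le
    · simp [ContinuousLinearMap.det]
  obtain ⟨t, ⟨ht0, ht1⟩, ht⟩ := intermediate_value_Icc zero_le_one hcont.continuousOn h0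
  have htpos : 0 < t := by
    rcases ht0.eq_or_lt with rfl | h
    · simp only [sub_zero, one_smul, zero_smul, add_zero] at ht
      exact absurd ht hneg.ne
    · exact h
  have hker := LinearMap.bot_lt_ker_of_det_eq_zero ht
  obtain ⟨v, hv, hv0⟩ := (Submodule.ne_bot_iff _).1 hker.ne'
  have hv' : (1 - t) • A v + t • v = 0 := by simpa using hv
  have h1 : (1 - t) * inner ℝ (A v) v + t * inner ℝ v v = 0 := by
    rw [← real_inner_smul_left, ← real_inner_smul_left, ← inner_add_left, hv', inner_zero_left]
  have h2 : 0 < inner ℝ v v := real_inner_self_pos.2 hv0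
  nlinarith [mul_nonneg (sub_nonneg.2 ht1) (hA v), mul_pos htpos h2]

lemma IsConvexPotential.det_fderiv_nonneg [FiniteDimensional ℝ E] (h : IsConvexPotential S φ T)
    (u : E) : 0 ≤ (fderiv ℝ T u).det :=
  det_nonneg_of_inner_nonneg _ (h.inner_fderiv_nonneg u)

lemma IsConvexPotential.injOn [FiniteDimensional ℝ E] (h : IsConvexPotential S φ T) :
    InjOn T {u | (fderiv ℝ T u).det ≠ 0} := by
  intro u hu v _ huv
  by_contra hne
  have hconst : ∀ t ∈ Icc (0 : ℝ) 1, T (u + t • (v - u)) = T u := by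
    intro t ht
    have hval : ∀ w, φ u + inner ℝ (T u) (w - u) ≤ φ w := h.le u
    have hz : φ (u + t • (v - u)) = φ u + inner ℝ (T u) (u + t • (v - u) - u) := by
      refine le_antisymm ?_ (hval _)
      have h1 := h.le (u + t • (v - u)) u
      have h2 := h.le (u + t • (v - u)) v
      have e1 : u - (u + t • (v - u)) = (-t) • (v - u) := by module
      have e2 : v - (u + t • (v - u)) = (1 - t) • (v - u) := by module
      have h3 := h.le v u
      rw [← huv, ← neg_sub v u, inner_neg_right] at h3
      rw [e1, real_inner_smul_right] at h1
      rw [e2, real_inner_smul_right] at h2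
      rw [add_sub_cancel_left, real_inner_smul_right]
      nlinarith [mul_le_mul_of_nonneg_left h1 (sub_nonneg.2 ht.2),
        mul_le_mul_of_nonneg_left h2 ht.1, mul_le_mul_of_nonneg_left h3 ht.1]
    have hmin : IsLocalMin (fun w => φ w - inner ℝ (T u) w) (u + t • (v - u)) := by
      refine Eventually.of_forall fun w => ?_
      have := hval w
      simp only [hz]
      rw [inner_sub_right] at this ⊢
      linarith
    have hd : HasFDerivAt (fun w => φ w - inner ℝ (T u) w)
        (innerSL ℝ (T (u + t • (v - u))) - innerSL ℝ (T u)) (u + t • (v - u)) :=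
      (h.hasFDerivAt _).sub (innerSL ℝ (T u)).hasFDerivAt
    have := hmin.hasFDerivAt_eq_zero hd
    refine ext_inner_right ℝ fun w => ?_
    simpa [sub_eq_zero] using DFunLike.congr_fun this w
  have h3 : HasDerivWithinAt (fun t : ℝ => T (u + t • (v - u))) 0 (Icc 0 1) 0 :=
    (hasDerivWithinAt_const (0 : ℝ) (Icc 0 1) (T u)).congr hconst (hconst 0 (by simp))
  have h4 : fderiv ℝ T u (v - u) = 0 :=
    (uniqueDiffOn_Icc zero_lt_one _ (by simp)).eq_deriv _
      (h.hasDerivAt_line u (v - u)).hasDerivWithinAt h3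
  refine hu (LinearMap.det_eq_zero_iff_ker_ne_bot.2 ?_)
  exact (Submodule.ne_bot_iff _).2 ⟨v - u, by simpa using h4, sub_ne_zero.2 (Ne.symm hne)⟩

lemma IsConvexPotential.interior_subset_range [FiniteDimensional ℝ E]
    (h : IsConvexPotential S φ T) : interior S ⊆ range T := by
  intro x hx
  obtain ⟨c, hc⟩ := h.growth
  obtain ⟨δ, hδ, hball⟩ := Metric.isOpen_iff.1 isOpen_interior x hx
  have hball' : Metric.ball x δ ⊆ S := hball.trans interior_subset
  have hcont : Continuous fun u => φ u - inner ℝ x u :=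
    (continuous_iff_continuousAt.2 fun u => (h.hasFDerivAt u).continuousAt).sub (by fun_prop)
  have hgrow : ∀ u, δ / 2 * ‖u‖ - c ≤ φ u - inner ℝ x u := by
    intro u
    rcases eq_or_ne u 0 with rfl | hu
    · have := hc x (hball' (Metric.mem_ball_self hδ)) 0
      simp only [inner_zero_right] at this
      simpa using this
    · have hn : 0 < ‖u‖ := norm_pos_iff.2 hu
      have hmem : x + (δ / 2 / ‖u‖) • u ∈ S := by
        refine hball' ?_
        rw [Metric.mem_ball, dist_eq_norm, add_sub_cancel_left, norm_smul, Real.norm_eq_abs,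
          abs_of_nonneg (by positivity), div_mul_cancel₀ _ hn.ne']
        linarith
      have := hc _ hmem u
      rw [inner_add_left, real_inner_smul_left, real_inner_self_eq_norm_sq] at this
      have e : δ / 2 / ‖u‖ * ‖u‖ ^ 2 = δ / 2 * ‖u‖ := by field_simp
      rw [e] at this
      linarith
  have hlim : Tendsto (fun u => φ u - inner ℝ x u) (cocompact E) atTop := by
    have : ProperSpace E := FiniteDimensional.proper ℝ E
    refine tendsto_atTop_mono hgrow ?_
    exact tendsto_atTop_add_const_right _ _
      ((tendsto_norm_cocompact_atTop (E := E)).const_mul_atTop (by positivity))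
  obtain ⟨u, hu⟩ := hcont.exists_forall_le hlim
  refine ⟨u, ?_⟩
  have hd : HasFDerivAt (fun w => φ w - inner ℝ x w) (innerSL ℝ (T u) - innerSL ℝ x) u :=
    (h.hasFDerivAt _).sub (innerSL ℝ x).hasFDerivAt
  have h0 := IsLocalMin.hasFDerivAt_eq_zero (Eventually.of_forall hu) hd
  refine ext_inner_right ℝ fun w => ?_
  simpa [sub_eq_zero] using DFunLike.congr_fun h0 w

/-- A gradient of a convex potential transports its Jacobian to the uniform measure on `S`. -/
lemma IsConvexPotential.map_withDensity [FiniteDimensional ℝ E] [MeasurableSpace E] [BorelSpace E]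
    (μ : Measure E) [μ.IsAddHaarMeasure] (h : IsConvexPotential S φ T) (hS : Convex ℝ S) :
    (μ.withDensity fun u => ENNReal.ofReal (fderiv ℝ T u).det).map T = μ.restrict S := by
  set U : Set E := {u | (fderiv ℝ T u).det ≠ 0} with hU
  have hcont : Continuous fun u => (fderiv ℝ T u).det :=
    ContinuousLinearMap.continuous_det.comp (h.contDiff.continuous_fderiv (by simp))
  have hUmeas : MeasurableSet U := (isOpen_ne_fun hcont continuous_const).measurableSet
  have hder : ∀ s : Set E, ∀ u ∈ s, HasFDerivWithinAt T (fderiv ℝ T u) s u := fun s u _ =>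
    (h.differentiable u).hasFDerivAt.hasFDerivWithinAt
  have h1 := map_withDensity_abs_det_fderiv_eq_addHaar μ hUmeas.nullMeasurableSet (hder U) h.injOn
  have h2 : (μ.restrict U).withDensity (fun u => ENNReal.ofReal |(fderiv ℝ T u).det|) =
      μ.withDensity fun u => ENNReal.ofReal (fderiv ℝ T u).det := by
    rw [← withDensity_indicator hUmeas]
    congr 1
    funext u
    by_cases hu : u ∈ U
    · rw [indicator_of_mem hu, abs_of_nonneg (h.det_fderiv_nonneg u)]
    · rw [indicator_of_notMem hu]
      have : (fderiv ℝ T u).det = 0 := by simpa [hU] using hu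
      simp [this]
  rw [← h2, h1]
  refine Measure.restrict_congr_set ?_
  have hnull : μ (T '' Uᶜ) = 0 :=
    addHaar_image_eq_zero_of_det_fderivWithin_eq_zero μ (hder Uᶜ) fun u hu => by
      simpa [hU] using hu
  have hsub : T '' U ⊆ S := by
    rintro _ ⟨u, _, rfl⟩
    exact h.mem u
  refine (LE.le.eventuallyLE hsub).antisymm (ae_le_set.2 ?_)
  refine measure_mono_null ?_ (measure_union_null (hS.addHaar_frontier μ) hnull)
  rintro x ⟨hxS, hxT⟩
  by_cases hx : x ∈ interior S
  · obtain ⟨u, rfl⟩ := h.interior_subset_range hx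
    exact Or.inr ⟨u, fun hu => hxT ⟨u, hu, rfl⟩, rfl⟩
  · exact Or.inl ⟨subset_closure hxS, hx⟩

/-- The support function of a set. -/
def supportFun (S : Set E) (u : E) : ℝ := sSup ((fun a => inner ℝ a u) '' S)

lemma IsCompact.inner_le_supportFun (hS : IsCompact S) {a : E} (ha : a ∈ S) (u : E) :
    inner ℝ a u ≤ supportFun S u :=
  le_csSup (hS.image (by fun_prop)).bddAbove (mem_image_of_mem _ ha)

lemma supportFun_le (hne : S.Nonempty) {u : E} {c : ℝ} (h : ∀ a ∈ S, inner ℝ a u ≤ c) :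
    supportFun S u ≤ c :=
  csSup_le (hne.image _) (by rintro _ ⟨a, ha, rfl⟩; exact h a ha)

lemma IsCompact.supportFun_add_le (hS : IsCompact S) (hne : S.Nonempty) (u v : E) :
    supportFun S (u + v) ≤ supportFun S u + supportFun S v :=
  supportFun_le hne fun a ha => by
    rw [inner_add_right]
    exact add_le_add (hS.inner_le_supportFun ha u) (hS.inner_le_supportFun ha v)

lemma IsCompact.convexOn_supportFun (hS : IsCompact S) (hne : S.Nonempty) :
    ConvexOn ℝ univ (supportFun S) := by
  refine ⟨convex_univ, fun u _ v _ a b ha hb _ => supportFun_le hne fun x hx => ?_⟩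
  rw [inner_add_right, real_inner_smul_right, real_inner_smul_right]
  exact add_le_add (mul_le_mul_of_nonneg_left (hS.inner_le_supportFun hx u) ha)
    (mul_le_mul_of_nonneg_left (hS.inner_le_supportFun hx v) hb)

lemma IsCompact.continuous_supportFun (hS : IsCompact S) (hne : S.Nonempty) :
    Continuous (supportFun S) := by
  obtain ⟨R, hR⟩ := hS.isBounded.exists_norm_le
  refine (LipschitzWith.of_le_add_mul (Real.toNNReal R) fun u v => ?_).continuous
  refine supportFun_le hne fun a ha => ?_
  have h1 : inner ℝ a u = inner ℝ a v + inner ℝ a (u - v) := by rw [← inner_add_right]; simp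
  have h2 : inner ℝ a (u - v) ≤ Real.toNNReal R * dist u v := by
    rw [dist_eq_norm]
    refine (real_inner_le_norm _ _).trans ?_
    gcongr
    exact (hR a ha).trans (Real.le_coe_toNNReal R)
  rw [h1]
  exact add_le_add (hS.inner_le_supportFun ha v) h2

lemma mem_of_forall_inner_le_supportFun [CompleteSpace E] (hS : IsCompact S) (hne : S.Nonempty)
    (hconv : Convex ℝ S) {x : E} (hx : ∀ v, inner ℝ x v ≤ supportFun S v) : x ∈ S := by
  by_contra hxS
  obtain ⟨f, c, hf, hc⟩ := geometric_hahn_banach_closed_point hconv hS.isClosed hxS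
  have hrep : ∀ y, inner ℝ y ((InnerProductSpace.toDual ℝ E).symm f) = f y := fun y => by
    rw [real_inner_comm, InnerProductSpace.toDual_symm_apply]
  have h1 := hx ((InnerProductSpace.toDual ℝ E).symm f)
  have h2 : supportFun S ((InnerProductSpace.toDual ℝ E).symm f) ≤ c :=
    supportFun_le hne fun a ha => by
      rw [hrep]
      exact (hf a ha).le
  rw [hrep] at h1
  linarith

open scoped Convolution in
/-- Mollifying the support function of a convex body gives a convex potential. -/
lemma exists_isConvexPotential [FiniteDimensional ℝ E] [MeasurableSpace E] [BorelSpace E]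
    (hS : IsCompact S) (hne : S.Nonempty) (hconv : Convex ℝ S) :
    ∃ φ T, IsConvexPotential S φ T := by
  let μ : Measure E := Measure.addHaar
  let β : ContDiffBump (0 : E) := ⟨1, 2, one_pos, one_lt_two⟩
  let ρ : E → ℝ := β.normed μ
  have hρ0 : ∀ z, 0 ≤ ρ z := fun z => β.nonneg_normed z
  have hρ1 : ∫ z, ρ z ∂μ = 1 := β.integral_normed
  have hρc : HasCompactSupport ρ := β.hasCompactSupport_normed
  have hρi : Integrable ρ μ := β.integrable_normed
  have hcont := hS.continuous_supportFun hne
  let φ : E → ℝ := fun u => ∫ z, ρ z * supportFun S (u - z) ∂μ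
  have hφconv : φ = ρ ⋆[ContinuousLinearMap.lsmul ℝ ℝ, μ] supportFun S := by
    funext u
    simp [φ, convolution_def]
  have hφ : ContDiff ℝ ∞ φ := by
    rw [hφconv]
    exact hρc.contDiff_convolution_left _ β.contDiff_normed hcont.locallyIntegrable
  have h_int : ∀ f : E → ℝ, Continuous f → Integrable (fun z => ρ z * f z) μ := fun f hf =>
    (β.continuous_normed.mul hf).integrable_of_hasCompactSupport (hρc.mul_right)
  have h_int' : ∀ u, Integrable (fun z => ρ z * supportFun S (u - z)) μ := fun u =>
    h_int _ (hcont.comp (by fun_prop))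
  have hφcvx : ConvexOn ℝ univ φ := by
    refine ⟨convex_univ, fun u _ v _ a b ha hb hab => ?_⟩
    simp only [φ, smul_eq_mul]
    rw [← integral_const_mul, ← integral_const_mul,
      ← integral_add ((h_int' u).const_mul a) ((h_int' v).const_mul b)]
    refine integral_mono (h_int' _) (((h_int' u).const_mul a).add ((h_int' v).const_mul b))
      fun z => ?_
    have h1 := (hS.convexOn_supportFun hne).2 (mem_univ (u - z)) (mem_univ (v - z)) ha hb hab
    have e : a • u + b • v - z = a • (u - z) + b • (v - z) := by
      have : z = (a + b) • z := by rw [hab, one_smul]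
      nth_rewrite 1 [this]
      module
    rw [← e] at h1
    simp only [smul_eq_mul] at h1
    have := mul_le_mul_of_nonneg_left h1 (hρ0 z)
    simp only
    linarith
  let T : E → E := fun u => (InnerProductSpace.toDual ℝ E).symm (fderiv ℝ φ u)
  have hT : ∀ u v, inner ℝ (T u) v = fderiv ℝ φ u v := fun u v =>
    InnerProductSpace.toDual_symm_apply
  have hle : ∀ u v, φ u + inner ℝ (T u) (v - u) ≤ φ v := by
    intro u v
    have h1 := hφcvx.comp_affineMap (AffineMap.lineMap u v : ℝ →ᵃ[ℝ] E)
    have h2 : HasDerivAt (φ ∘ (AffineMap.lineMap u v : ℝ →ᵃ[ℝ] E)) (fderiv ℝ φ u (v - u)) 0 := by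
      have h3 := (hφ.differentiable (by simp)
        ((AffineMap.lineMap u v : ℝ →ᵃ[ℝ] E) 0)).hasFDerivAt.comp_hasDerivAt (0 : ℝ)
        AffineMap.hasDerivAt_lineMap
      simpa using h3
    have h4 := h1.le_slope_of_hasDerivAt (mem_univ (0 : ℝ)) (mem_univ (1 : ℝ)) one_pos h2
    simp only [slope_def_field, Function.comp_apply, AffineMap.lineMap_apply_one,
      AffineMap.lineMap_apply_zero, sub_zero, div_one] at h4
    rw [hT]
    linarith
  refine ⟨φ, T, ?_, ?_, hle, ?_, ?_⟩
  · exact (InnerProductSpace.toDual ℝ E).symm.contDiff.comp (hφ.fderiv_right (by norm_cast))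
  · intro u
    have : innerSL ℝ (T u) = fderiv ℝ φ u := by
      ext v
      exact hT u v
    rw [this]
    exact (hφ.differentiable (by simp) u).hasFDerivAt
  · intro u
    refine mem_of_forall_inner_le_supportFun hS hne hconv fun v => ?_
    have h1 := hle u (u + v)
    rw [add_sub_cancel_left] at h1
    have h2 : φ (u + v) ≤ φ u + supportFun S v := by
      have h3 : supportFun S v = ∫ z, ρ z * supportFun S v ∂μ := by
        rw [integral_mul_const, hρ1, one_mul]
      rw [h3, ← integral_add (h_int' u) (hρi.mul_const _)]
      refine integral_mono (h_int' _) ((h_int' u).add (hρi.mul_const _)) fun z => ?_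
      have h4 := hS.supportFun_add_le hne (u - z) v
      rw [sub_add_eq_add_sub] at h4
      simp only [← mul_add]
      exact mul_le_mul_of_nonneg_left h4 (hρ0 z)
    linarith
  · obtain ⟨R, hR⟩ := hS.isBounded.exists_norm_le
    refine ⟨∫ z, ρ z * (R * ‖z‖) ∂μ, fun a ha u => ?_⟩
    have h3 : inner ℝ a u = ∫ z, ρ z * inner ℝ a u ∂μ := by
      rw [integral_mul_const, hρ1, one_mul]
    rw [h3, ← integral_sub (hρi.mul_const _) (h_int _ (by fun_prop))]
    refine integral_mono ((hρi.mul_const _).sub (h_int _ (by fun_prop))) (h_int' _) fun z => ?_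
    simp only [← mul_sub]
    refine mul_le_mul_of_nonneg_left ?_ (hρ0 z)
    have h4 := hS.inner_le_supportFun ha (u - z)
    rw [inner_sub_right] at h4
    have h5 : inner ℝ a z ≤ R * ‖z‖ := (real_inner_le_norm _ _).trans (by
      gcongr
      exact hR a ha)
    linarith

end ConvexPotential

section LagrangeNodes

/-- The product of the values at `l i` of the Lagrange basis polynomials with nodes `0, …, n`. -/
def lagrangeWeight {ι : Type*} [Fintype ι] {n : ℕ} (j : ι → Fin (n + 1)) (l : ι → ℝ) : ℝ :=
  ∏ i, (Lagrange.basis Finset.univ (fun a : Fin (n + 1) => (a : ℝ)) (j i)).eval (l i)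

variable {ι : Type*} [Fintype ι] {n : ℕ}

lemma contDiff_lagrangeWeight (j : ι → Fin (n + 1)) : ContDiff ℝ ∞ (lagrangeWeight j) := by
  refine contDiff_prod fun i _ => ?_
  exact (Polynomial.contDiff_aeval _ _).comp (contDiff_apply ℝ ℝ i)

lemma pow_eq_sum_lagrange {a : ℕ} (ha : a ≤ n) (x : ℝ) :
    x ^ a = ∑ b : Fin (n + 1),
      (Lagrange.basis Finset.univ (fun b : Fin (n + 1) => (b : ℝ)) b).eval x * (b : ℝ) ^ a := by
  have h := Lagrange.eq_interpolate (s := Finset.univ) (v := fun b : Fin (n + 1) => (b : ℝ))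
    (f := (Polynomial.X : Polynomial ℝ) ^ a)
    (fun b _ c _ hbc => Fin.ext (Nat.cast_injective hbc)) (by
      rw [Polynomial.degree_X_pow, Finset.card_univ, Fintype.card_fin]
      exact_mod_cast Nat.lt_succ_of_le ha)
  have h2 := congrArg (Polynomial.eval x) h
  rw [Lagrange.interpolate_apply, Polynomial.eval_finsetSum] at h2
  simpa [mul_comm] using h2

lemma eval_eq_sum_lagrangeWeight [DecidableEq ι] (P : MvPolynomial ι ℝ) (hP : P.totalDegree ≤ n)
    (l : ι → ℝ) :
    MvPolynomial.eval l P = ∑ j : ι → Fin (n + 1),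
      lagrangeWeight j l * MvPolynomial.eval (fun i => (j i : ℝ)) P := by
  simp only [MvPolynomial.eval_eq', Finset.mul_sum]
  rw [Finset.sum_comm]
  refine Finset.sum_congr rfl fun d hd => ?_
  have hdi : ∀ i, d i ≤ n := fun i =>
    ((MvPolynomial.monomial_le_degreeOf i hd).trans
      (MvPolynomial.degreeOf_le_totalDegree P i)).trans hP
  rw [Finset.prod_congr rfl fun i _ => pow_eq_sum_lagrange (hdi i) (l i), Finset.prod_univ_sum,
    Fintype.piFinset_univ, Finset.mul_sum]
  refine Finset.sum_congr rfl fun j _ => ?_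
  rw [lagrangeWeight, Finset.prod_mul_distrib]
  ring

lemma exists_totalDegree_le_eval_eq_det {E : Type*} [NormedAddCommGroup E] [NormedSpace ℝ E]
    [FiniteDimensional ℝ E] (A : ι → E →L[ℝ] E) :
    ∃ P : MvPolynomial ι ℝ, P.totalDegree ≤ Module.finrank ℝ E ∧
      ∀ l, MvPolynomial.eval l P = (∑ i, l i • A i).det := by
  classical
  let b := Module.finBasis ℝ E
  let N : ι → Matrix (Fin (Module.finrank ℝ E)) (Fin (Module.finrank ℝ E)) ℝ :=
    fun i => LinearMap.toMatrix b b (A i : E →ₗ[ℝ] E)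
  let Q : Matrix (Fin (Module.finrank ℝ E)) (Fin (Module.finrank ℝ E)) (MvPolynomial ι ℝ) :=
    Matrix.of fun r s => ∑ i, MvPolynomial.C (N i r s) * MvPolynomial.X i
  refine ⟨Q.det, ?_, fun l => ?_⟩
  · rw [Matrix.det_apply]
    refine MvPolynomial.totalDegree_finsetSum_le fun σ _ => ?_
    rw [Units.smul_def, zsmul_eq_mul, ← map_intCast (MvPolynomial.C : ℝ →+* MvPolynomial ι ℝ)]
    refine (MvPolynomial.totalDegree_mul _ _).trans ?_
    rw [MvPolynomial.totalDegree_C, zero_add]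
    refine (MvPolynomial.totalDegree_finsetProd _ _).trans ?_
    refine (Finset.sum_le_sum (g := fun _ => 1) fun r _ => ?_).trans (by simp)
    refine MvPolynomial.totalDegree_finsetSum_le fun i _ => ?_
    refine (MvPolynomial.totalDegree_mul _ _).trans ?_
    rw [MvPolynomial.totalDegree_C, zero_add, MvPolynomial.totalDegree_X]
  · rw [RingHom.map_det, ContinuousLinearMap.det, ← LinearMap.det_toMatrix b]
    congr 1
    ext r s
    simp [Q, N, Matrix.sum_apply, mul_comm]

end LagrangeNodes

section RepresentingMeasures

variable {ι : Type*} [Fintype ι] {n : ℕ} {E : Type*} [NormedAddCommGroup E]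

lemma isCompact_sum_smul [NormedSpace ℝ E] {A : ι → Set E} (hA : ∀ i, IsCompact (A i))
    (l : ι → ℝ) : IsCompact (∑ i, l i • A i) :=
  Finset.sum_induction _ IsCompact (fun _ _ => IsCompact.add) isCompact_singleton
    fun i _ => (hA i).smul (l i)

lemma convex_sum_smul [NormedSpace ℝ E] {A : ι → Set E} (hA : ∀ i, Convex ℝ (A i))
    (l : ι → ℝ) : Convex ℝ (∑ i, l i • A i) :=
  Finset.sum_induction _ (Convex ℝ) (fun _ _ => Convex.add) (convex_singleton 0)
    fun i _ => (hA i).smul (l i)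

/-- The integrand that represents the integral of `f` over the Minkowski combination
`∑ i, l i • A i`, as a function of the coefficients `l` and of points `c i` of the bodies. -/
def minkowskiIntegrand [NormedSpace ℝ E] (f : E → ℂ) (j : ι → Fin (n + 1))
    (z : (ι → ℝ) × (ι → E)) : ℂ :=
  (lagrangeWeight j z.1 : ℂ) * f (∑ i, z.1 i • z.2 i)

lemma contDiff_minkowskiIntegrand [NormedSpace ℝ E] {f : E → ℂ} (hf : ContDiff ℝ ∞ f)
    (j : ι → Fin (n + 1)) : ContDiff ℝ ∞ (minkowskiIntegrand f j) := by
  refine ContDiff.mul ?_ (hf.comp (ContDiff.sum fun i _ => ContDiff.smul ?_ ?_))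
  · exact Complex.ofRealCLM.contDiff.comp ((contDiff_lagrangeWeight j).comp contDiff_fst)
  · exact (contDiff_apply ℝ ℝ i).comp contDiff_fst
  · exact (contDiff_apply ℝ E i).comp contDiff_snd

lemma continuous_minkowskiIntegrand [NormedSpace ℝ E] {f : E → ℂ} (hf : Continuous f)
    (j : ι → Fin (n + 1)) (l : ι → ℝ) : Continuous fun c => minkowskiIntegrand f j (l, c) := by
  have : Continuous fun c : ι → E => ∑ i, l i • c i := by fun_prop
  change Continuous fun c : ι → E => (lagrangeWeight j l : ℂ) * f (∑ i, l i • c i)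
  exact continuous_const.mul (hf.comp this)

variable [DecidableEq ι]

/-- The measures `ν j` represent the integrals of continuous functions over the Minkowski
combinations of the bodies `A i`. -/
structure IsRepresenting [NormedSpace ℝ E] [MeasurableSpace E] (μ : Measure E) (A : ι → Set E)
    (ν : (ι → Fin (n + 1)) → Measure (ι → E)) : Prop where
  univ_eq : ∀ j, ν j univ = μ (∑ i, (j i : ℝ) • A i)
  ae_mem : ∀ j, ∀ᵐ c ∂ν j, ∀ i, c i ∈ A i
  setIntegral_eq : ∀ f : E → ℂ, Continuous f → ∀ l : ι → ℝ, 0 ≤ l →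
    ∫ x in ∑ i, l i • A i, f x ∂μ = paramIntegral ν (minkowskiIntegrand f) l

lemma exists_isRepresenting_of_inner [InnerProductSpace ℝ E] [FiniteDimensional ℝ E]
    [MeasurableSpace E] [BorelSpace E] (hn : Module.finrank ℝ E ≤ n) (μ : Measure E)
    [μ.IsAddHaarMeasure] {A : ι → Set E} (hA : ∀ i, IsCompact (A i)) (hne : ∀ i, (A i).Nonempty)
    (hconv : ∀ i, Convex ℝ (A i)) :
    ∃ ν : (ι → Fin (n + 1)) → Measure (ι → E), IsRepresenting μ A ν := by
  have : ProperSpace E := FiniteDimensional.proper ℝ E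
  have : SecondCountableTopology E := secondCountable_of_proper
  choose φ T hT using fun i => exists_isConvexPotential (hA i) (hne i) (hconv i)
  let w : (ι → ℝ) → E → ℝ := fun l u => (∑ i, l i • fderiv ℝ (T i) u).det
  have hTc : ∀ i, Continuous (T i) := fun i => (hT i).contDiff.continuous
  have hwc : ∀ l, Continuous (w l) := fun l =>
    ContinuousLinearMap.continuous_det.comp (continuous_finsetSum _ fun i _ => by
      have := (hT i).contDiff.continuous_fderiv (by simp)
      fun_prop)
  have hwm : ∀ l, Measurable fun u => ENNReal.ofReal (w l u) := fun l =>
    (hwc l).measurable.ennreal_ofReal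
  have hpot : ∀ l : ι → ℝ, 0 ≤ l → _ := fun l hl => IsConvexPotential.sum hT hl
  have hfd : ∀ (l : ι → ℝ) (u : E),
      fderiv ℝ (fun u => ∑ i, l i • T i u) u = ∑ i, l i • fderiv ℝ (T i) u := by
    intro l u
    exact (HasFDerivAt.fun_sum fun i _ =>
      ((hT i).differentiable u).hasFDerivAt.const_smul (l i)).fderiv
  have hmap : ∀ l : ι → ℝ, 0 ≤ l → (μ.withDensity fun u => ENNReal.ofReal (w l u)).map
      (fun u => ∑ i, l i • T i u) = μ.restrict (∑ i, l i • A i) := by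
    intro l hl
    have := (hpot l hl).map_withDensity μ (convex_sum_smul hconv l)
    simpa only [hfd] using this
  have hw0 : ∀ l : ι → ℝ, 0 ≤ l → ∀ u, 0 ≤ w l u := by
    intro l hl u
    have := (hpot l hl).det_fderiv_nonneg u
    rwa [hfd] at this
  have hTm : Measurable fun u i => T i u := measurable_pi_lambda _ fun i => (hTc i).measurable
  have hlc : ∀ l : ι → ℝ, Continuous fun u => ∑ i, l i • T i u := fun l => by fun_prop
  have hnode : ∀ j : ι → Fin (n + 1), (0 : ι → ℝ) ≤ fun i => (j i : ℝ) := fun j i =>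
    Nat.cast_nonneg _
  let ρ : (ι → Fin (n + 1)) → Measure E := fun j =>
    μ.withDensity fun u => ENNReal.ofReal (w (fun i => (j i : ℝ)) u)
  have hρ : ∀ j, ρ j univ = μ (∑ i, (j i : ℝ) • A i) := by
    intro j
    have := congrArg (fun m => m univ) (hmap _ (hnode j))
    simpa only [Measure.map_apply (hlc _).measurable MeasurableSet.univ, preimage_univ,
      Measure.restrict_apply_univ] using this
  have hρfin : ∀ j, IsFiniteMeasure (ρ j) := fun j =>
    ⟨by rw [hρ]; exact (isCompact_sum_smul hA _).measure_lt_top⟩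
  refine ⟨fun j => (ρ j).map fun u i => T i u, ⟨fun j => ?_, fun j => ?_, fun f hf l hl => ?_⟩⟩
  · rw [Measure.map_apply hTm MeasurableSet.univ, preimage_univ, hρ]
  · rw [ae_map_iff hTm.aemeasurable]
    · exact Eventually.of_forall fun u i => (hT i).mem u
    · rw [ofPred_forall]
      exact MeasurableSet.iInter fun i => (hA i).isClosed.measurableSet.preimage
        (measurable_pi_apply i)
  · have hfl : Continuous fun u => f (∑ i, l i • T i u) := hf.comp (hlc l)
    obtain ⟨M, hM⟩ := (isCompact_sum_smul hA l).exists_bound_of_continuousOn hf.continuousOn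
    have h_int : ∀ j, Integrable (fun u => f (∑ i, l i • T i u)) (ρ j) := fun j =>
      Integrable.of_bound hfl.aestronglyMeasurable M
        (Eventually.of_forall fun u => hM _ ((hpot l hl).mem u))
    have hsm : ∀ l' : ι → ℝ, 0 ≤ l' → ∀ h : E → ℂ,
        ∫ u, h u ∂(μ.withDensity fun u => ENNReal.ofReal (w l' u)) = ∫ u, w l' u • h u ∂μ := by
      intro l' hl' h
      rw [integral_withDensity_eq_integral_toReal_smul (hwm l')
        (Eventually.of_forall fun _ => ENNReal.ofReal_lt_top)]
      exact integral_congr_ae (Eventually.of_forall fun u => by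
        simp [ENNReal.toReal_ofReal (hw0 l' hl' u)])
    have h_int' : ∀ j : ι → Fin (n + 1), Integrable
        (fun u => w (fun i => (j i : ℝ)) u • f (∑ i, l i • T i u)) μ := by
      intro j
      have := (integrable_withDensity_iff_integrable_smul' (hwm fun i => (j i : ℝ))
        (Eventually.of_forall fun _ => ENNReal.ofReal_lt_top)).1 (h_int j)
      refine this.congr (Eventually.of_forall fun u => ?_)
      simp [ENNReal.toReal_ofReal (hw0 _ (hnode j) u)]
    have hW : ∀ u, w l u =
        ∑ j : ι → Fin (n + 1), lagrangeWeight j l * w (fun i => (j i : ℝ)) u := by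
      intro u
      obtain ⟨P, hP, hPe⟩ := exists_totalDegree_le_eval_eq_det fun i => fderiv ℝ (T i) u
      have := eval_eq_sum_lagrangeWeight P (hP.trans hn) l
      simpa only [hPe] using this
    rw [← hmap l hl, integral_map (hlc l).aemeasurable hf.aestronglyMeasurable, hsm l hl,
      paramIntegral]
    have hsum : ∀ u, w l u • f (∑ i, l i • T i u) = ∑ j : ι → Fin (n + 1),
        (lagrangeWeight j l : ℂ) * (w (fun i => (j i : ℝ)) u • f (∑ i, l i • T i u)) := by
      intro u
      rw [hW, Finset.sum_smul]
      refine Finset.sum_congr rfl fun j _ => ?_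
      simp [mul_assoc]
    rw [integral_congr_ae (Eventually.of_forall hsum),
      integral_finsetSum _ fun j _ => (h_int' j).const_mul _]
    refine Finset.sum_congr rfl fun j _ => ?_
    have hc := continuous_minkowskiIntegrand hf j l
    rw [integral_map hTm.aemeasurable hc.aestronglyMeasurable, hsm _ (hnode j),
      integral_congr_ae (Eventually.of_forall fun u => ?_)]
    simp only [minkowskiIntegrand, Complex.real_smul]
    ring

lemma exists_isRepresenting [NormedSpace ℝ E] [FiniteDimensional ℝ E]
    [MeasurableSpace E] [BorelSpace E] (hn : Module.finrank ℝ E ≤ n) (μ : Measure E)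
    [μ.IsAddHaarMeasure] {A : ι → Set E} (hA : ∀ i, IsCompact (A i)) (hne : ∀ i, (A i).Nonempty)
    (hconv : ∀ i, Convex ℝ (A i)) :
    ∃ ν : (ι → Fin (n + 1)) → Measure (ι → E), IsRepresenting μ A ν := by
  have : ProperSpace E := FiniteDimensional.proper ℝ E
  have : SecondCountableTopology E := secondCountable_of_proper
  let e : E ≃L[ℝ] EuclideanSpace ℝ (Fin (Module.finrank ℝ E)) := toEuclidean
  have := e.isAddHaarMeasure_map μ
  have hem : MeasurableEmbedding e := e.toHomeomorph.measurableEmbedding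
  obtain ⟨ν, hν⟩ := exists_isRepresenting_of_inner (n := n) (ι := ι) (by simpa using hn)
    (μ.map e) (A := fun i => e '' A i) (fun i => (hA i).image e.continuous)
    (fun i => (hne i).image e)
    (fun i => (hconv i).is_linear_image e.toLinearEquiv.toLinearMap.isLinear)
  have himg : ∀ l : ι → ℝ, e ⁻¹' (∑ i, l i • e '' A i) = ∑ i, l i • A i := by
    intro l
    have : ∑ i, l i • e '' A i = e '' (∑ i, l i • A i) := by
      rw [Set.image_finsetSum]
      exact Finset.sum_congr rfl fun i _ => (image_smul_set _ _ _).symm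
    rw [this, preimage_image_eq _ e.injective]
  have hem' : Measurable fun (c : ι → EuclideanSpace ℝ (Fin (Module.finrank ℝ E))) i =>
      e.symm (c i) :=
    measurable_pi_lambda _ fun i => e.symm.continuous.measurable.comp (measurable_pi_apply i)
  refine ⟨fun j => (ν j).map fun c i => e.symm (c i), fun j => ?_, fun j => ?_,
    fun f hf l hl => ?_⟩
  · rw [Measure.map_apply hem' MeasurableSet.univ, preimage_univ, hν.univ_eq, hem.map_apply, himg]
  · rw [ae_map_iff hem'.aemeasurable]
    · filter_upwards [hν.ae_mem j] with c hc i
      obtain ⟨a, ha, hac⟩ := hc i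
      simpa [← hac] using ha
    · rw [ofPred_forall]
      exact MeasurableSet.iInter fun i => (hA i).isClosed.measurableSet.preimage
        (measurable_pi_apply i)
  · have h1 := hν.setIntegral_eq (fun x => f (e.symm x)) (hf.comp e.symm.continuous) l hl
    rw [hem.setIntegral_map, himg] at h1
    simp only [ContinuousLinearEquiv.symm_apply_apply] at h1
    rw [h1, paramIntegral, paramIntegral]
    refine Finset.sum_congr rfl fun j _ => ?_
    have hc := continuous_minkowskiIntegrand hf j l
    rw [integral_map hem'.aemeasurable hc.aestronglyMeasurable]
    simp [minkowskiIntegrand]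

lemma IsRepresenting.boundedMeasures [NormedSpace ℝ E] [MeasurableSpace E] {μ : Measure E}
    {A A' : ι → Set E} {ν : (ι → Fin (n + 1)) → Measure (ι → E)} (hν : IsRepresenting μ A ν)
    (hAA' : ∀ i, A i ⊆ A' i) {M : NNReal} (hM : ∀ j : ι → Fin (n + 1),
      μ (∑ i, (j i : ℝ) • A' i) ≤ M) {R : ℝ} (hR : ∀ i, ∀ x ∈ A' i, ‖x‖ ≤ R) (hR0 : 0 ≤ R) :
    BoundedMeasures M R ν := by
  refine fun j => ⟨?_, ?_⟩
  · rw [hν.univ_eq]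
    refine (measure_mono ?_).trans (hM j)
    exact finsetSum_subset_finsetSum _ _ _ fun i _ => smul_set_mono (hAA' i)
  · filter_upwards [hν.ae_mem j] with c hc
    exact (pi_norm_le_iff_of_nonneg hR0).2 fun i => hR i _ (hAA' i (hc i))

lemma exists_measure_sum_smul_le [NormedSpace ℝ E] [MeasurableSpace E] (μ : Measure E)
    [IsFiniteMeasureOnCompacts μ] {A : ι → Set E} (hA : ∀ i, IsCompact (A i)) :
    ∃ M : NNReal, ∀ j : ι → Fin (n + 1), μ (∑ i, (j i : ℝ) • A i) ≤ M := by
  refine ⟨∑ j : ι → Fin (n + 1), (μ (∑ i, (j i : ℝ) • A i)).toNNReal, fun j => ?_⟩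
  rw [← ENNReal.coe_toNNReal (isCompact_sum_smul hA _).measure_lt_top.ne]
  exact_mod_cast Finset.single_le_sum
    (f := fun j : ι → Fin (n + 1) => (μ (∑ i, (j i : ℝ) • A i)).toNNReal)
    (fun i _ => zero_le) (Finset.mem_univ j)

lemma IsRepresenting.exists_boundedMeasures [NormedSpace ℝ E] [MeasurableSpace E] {μ : Measure E}
    [IsFiniteMeasureOnCompacts μ] {A : ι → Set E} {ν : (ι → Fin (n + 1)) → Measure (ι → E)}
    (hν : IsRepresenting μ A ν) (hA : ∀ i, IsCompact (A i)) : ∃ M R, BoundedMeasures M R ν := by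
  choose R hR using fun i => (hA i).isBounded.exists_norm_le
  obtain ⟨M, hM⟩ := exists_measure_sum_smul_le (n := n) μ hA
  refine ⟨M, ∑ i, |R i|,
    hν.boundedMeasures (fun i => Subset.rfl) hM (fun i x hx => ?_) (by positivity)⟩
  exact ((hR i x hx).trans (le_abs_self _)).trans
    (Finset.single_le_sum (f := fun i => |R i|) (fun i _ => abs_nonneg _) (Finset.mem_univ i))

end RepresentingMeasures

section Slices

lemma sum_smul_option {κ V : Type*} [Fintype κ] [AddCommMonoid V] [Module ℝ V] (l : κ → ℝ)
    (K : Set V) (X : κ → Set V) :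
    ∑ o : Option κ, (o.elim 1 l : ℝ) • (o.elim K X : Set V) = K + ∑ c, l c • X c := by
  rw [Fintype.sum_option]
  simp

lemma single_none_add_sum {κ : Type*} [Fintype κ] [DecidableEq κ] (l : κ → ℝ) :
    (Pi.single none 1 + ∑ c, l c • Pi.single (some c) 1 : Option κ → ℝ) =
      fun o => o.elim 1 l := by
  funext o
  cases o <;> simp [Finset.sum_apply, Pi.single_apply]

lemma mem_add_sum_smul_prod {κ V W : Type*} [Fintype κ] [AddCommGroup V] [Module ℝ V]
    [AddCommGroup W] [Module ℝ W] (K : Set (V × W)) (A : κ → Set V) (l : κ → ℝ) (x : V) (y : W) :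
    (x, y) ∈ K + ∑ i, l i • (A i ×ˢ ({0} : Set W)) ↔
      x ∈ {x | (x, y) ∈ K} + ∑ i, l i • A i := by
  have h : ∑ i, l i • (A i ×ˢ ({0} : Set W)) = LinearMap.inl ℝ V W '' (∑ i, l i • A i) := by
    rw [Set.image_finsetSum]
    refine Finset.sum_congr rfl fun i _ => ?_
    rw [image_smul_set]
    congr 1
    ext ⟨a, b⟩
    simp [eq_comm]
  rw [h]
  constructor
  · rintro ⟨⟨a, b⟩, hab, _, ⟨c, hc, rfl⟩, hs⟩
    simp only [LinearMap.inl_apply, Prod.mk_add_mk, add_zero, Prod.mk.injEq] at hs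
    obtain ⟨rfl, rfl⟩ := hs
    exact add_mem_add hab hc
  · rintro ⟨a, ha, c, hc, rfl⟩
    exact ⟨(a, y), ha, LinearMap.inl ℝ V W c, mem_image_of_mem _ hc, by simp⟩

variable {m q : ℕ}

lemma integral_indicator_slice (f : Euc m → ℂ) (g : Euc q → ℂ) {V : Set (Euc m × Euc q)}
    (hV : IsCompact V) (y : Euc q) :
    ∫ x, V.indicator (fun z => f z.1 * g z.2) (x, y) = g y * ∫ x in {x | (x, y) ∈ V}, f x := by
  have hm : MeasurableSet {x | (x, y) ∈ V} :=
    hV.measurableSet.preimage measurable_prodMk_right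
  rw [← integral_const_mul, ← integral_indicator hm]
  refine integral_congr_ae (Eventually.of_forall fun x => ?_)
  simp only [indicator, mem_ofPred_eq, mul_comm]

open Classical in
/-- Differentiating the integral over `K + ∑ λᵢ (Aᵢ × 0)` slice by slice. -/
lemma mixedPartialAtZero_setIntegral_eq_integral_slices {f : Euc m → ℂ} {g : Euc q → ℂ}
    (hf : ContDiff ℝ ∞ f) (hg : Continuous g) {k : ℕ} {A : Fin k → Set (Euc m)}
    (hA : ∀ i, IsCompact (A i)) (hAne : ∀ i, (A i).Nonempty) (hAconv : ∀ i, Convex ℝ (A i))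
    {K : Set (Euc m × Euc q)} (hK : IsCompact K) (hKconv : Convex ℝ K) :
    mixedPartialAtZero (fun lam : Fin k → ℝ =>
      ∫ z in K + ∑ i, lam i • (A i ×ˢ ({0} : Set (Euc q))), f z.1 * g z.2) =
    ∫ y, g y * if {x | (x, y) ∈ K}.Nonempty then
      mixedPartialAtZero (fun lam : Fin k → ℝ =>
        ∫ x in {x | (x, y) ∈ K} + ∑ i, lam i • A i, f x) else 0 := by
  have hSc : ∀ y, IsCompact {x | (x, y) ∈ K} := fun y =>
    (hK.image continuous_fst).of_isClosed_subset
      (hK.isClosed.preimage (Continuous.prodMk_left y)) fun x hx => ⟨(x, y), hx, rfl⟩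
  have hSconv : ∀ y, Convex ℝ {x | (x, y) ∈ K} := by
    intro y x hx x' hx' a b ha hb hab
    have := hKconv hx hx' ha hb hab
    simpa [← add_smul, hab] using this
  obtain ⟨R, hR0, hRK, hRA⟩ : ∃ R : ℝ, 0 ≤ R ∧ (∀ z ∈ K, ‖z.1‖ ≤ R) ∧
      ∀ i, ∀ x ∈ A i, ‖x‖ ≤ R := by
    obtain ⟨R₁, hR₁⟩ := hK.isBounded.exists_norm_le
    choose R₂ hR₂ using fun i => (hA i).isBounded.exists_norm_le
    refine ⟨|R₁| + ∑ i, |R₂ i|, by positivity, fun z hz => ?_, fun i x hx => ?_⟩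
    · exact ((norm_fst_le z).trans ((hR₁ z hz).trans (le_abs_self _))).trans
        (le_add_of_nonneg_right (by positivity))
    · refine ((hR₂ i x hx).trans (le_abs_self _)).trans ?_
      exact (Finset.single_le_sum (f := fun i => |R₂ i|) (fun i _ => abs_nonneg _)
        (Finset.mem_univ i)).trans (le_add_of_nonneg_left (abs_nonneg _))
  let n := Module.finrank ℝ (Euc m)
  let D : Option (Fin k) → Set (Euc m) := fun _ => Metric.closedBall 0 R
  obtain ⟨M, hM⟩ := exists_measure_sum_smul_le (n := n) (volume : Measure (Euc m)) (A := D)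
    fun _ => isCompact_closedBall 0 R
  have hν : ∀ y, ∃ ν : (Option (Fin k) → Fin (n + 1)) → Measure (Option (Fin k) → Euc m),
      BoundedMeasures M R ν ∧ ({x | (x, y) ∈ K}.Nonempty →
        IsRepresenting volume (fun o => o.elim {x | (x, y) ∈ K} A) ν) := by
    intro y
    by_cases hne : {x | (x, y) ∈ K}.Nonempty
    · obtain ⟨ν, hν⟩ := exists_isRepresenting (n := n) le_rfl (volume : Measure (Euc m))
        (A := fun o : Option (Fin k) => o.elim {x | (x, y) ∈ K} A)
        (by rintro (_ | i); exacts [hSc y, hA i]) (by rintro (_ | i); exacts [hne, hAne i])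
        (by rintro (_ | i); exacts [hSconv y, hAconv i])
      refine ⟨ν, hν.boundedMeasures (A' := D) ?_ hM (by simp [D]) hR0, fun _ => hν⟩
      rintro (_ | i) x hx
      · simpa [D] using hRK (x, y) hx
      · simpa [D] using hRA i x hx
    · exact ⟨0, fun j => by simp, fun h => absurd h hne⟩
  choose ν hνb hν using hν
  have hslice : ∀ y, {x | (x, y) ∈ K}.Nonempty → ∀ lam : Fin k → ℝ, 0 ≤ lam →
      ∫ x in {x | (x, y) ∈ K} + ∑ i, lam i • A i, f x = paramIntegral (ν y) (minkowskiIntegrand f)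
        (Pi.single none 1 + ∑ i, lam i • Pi.single (some i) 1) := by
    intro y hy lam hlam
    rw [single_none_add_sum, ← sum_smul_option]
    refine (hν y hy).setIntegral_eq f hf.continuous _ ?_
    rintro (_ | i)
    exacts [zero_le_one, hlam i]
  let b : Euc q → ℂ := (Prod.snd '' K).indicator g
  have hb : Integrable b := by
    have hc : IsCompact (Prod.snd '' K) := hK.image continuous_snd
    exact (integrable_indicator_iff hc.measurableSet).2 (hg.continuousOn.integrableOn_compact hc)
  have hb1 : ∀ y, {x | (x, y) ∈ K}.Nonempty → b y = g y := fun y ⟨x, hx⟩ =>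
    indicator_of_mem (mem_image_of_mem Prod.snd hx) g
  have hb0 : ∀ y, ¬{x | (x, y) ∈ K}.Nonempty → b y = 0 := by
    intro y hy
    refine indicator_of_notMem ?_ g
    rintro ⟨⟨x, y'⟩, hx, rfl⟩
    exact hy ⟨x, hx⟩
  let V : (Fin k → ℝ) → Set (Euc m × Euc q) := fun lam =>
    K + ∑ i, lam i • (A i ×ˢ ({0} : Set (Euc q)))
  have hV : ∀ lam, IsCompact (V lam) := fun lam =>
    hK.add (isCompact_sum_smul (fun i => (hA i).prod isCompact_singleton) lam)
  have hfg : Continuous fun z : Euc m × Euc q => f z.1 * g z.2 :=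
    (hf.continuous.comp continuous_fst).mul (hg.comp continuous_snd)
  have h_int : ∀ lam, Integrable ((V lam).indicator fun z => f z.1 * g z.2)
      ((volume : Measure (Euc m)).prod (volume : Measure (Euc q))) := by
    intro lam
    rw [integrable_indicator_iff (hV lam).measurableSet]
    exact hfg.continuousOn.integrableOn_compact (hV lam)
  have hpt : ∀ lam : Fin k → ℝ, 0 ≤ lam → ∀ y,
      ∫ x, (V lam).indicator (fun z => f z.1 * g z.2) (x, y) =
        b y * paramIntegral (ν y) (minkowskiIntegrand f)
          (Pi.single none 1 + ∑ i, lam i • Pi.single (some i) 1) := by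
    intro lam hlam y
    rw [integral_indicator_slice f g (hV lam)]
    have : {x | (x, y) ∈ V lam} = {x | (x, y) ∈ K} + ∑ i, lam i • A i :=
      Set.ext fun x => mem_add_sum_smul_prod K A lam x y
    rw [this]
    by_cases hy : {x | (x, y) ∈ K}.Nonempty
    · rw [hslice y hy lam hlam, hb1 y hy]
    · rw [hb0 y hy, not_nonempty_iff_eq_empty.1 hy]
      simp
  rw [mixedPartialAtZero_integral hνb hb (Pi.single none 1) (fun i => Pi.single (some i) 1)
    (Ψ := minkowskiIntegrand f) (contDiff_minkowskiIntegrand hf)]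
  · refine integral_congr_ae (Eventually.of_forall fun y => ?_)
    by_cases hy : {x | (x, y) ∈ K}.Nonempty
    · simp only [if_pos hy, hb1 y hy]
      rw [mixedPartialAtZero_paramIntegral (hνb y) (Pi.single none 1)
        (fun i => Pi.single (some i) 1) (contDiff_minkowskiIntegrand hf) (hslice y hy)]
    · simp [if_neg hy, hb0 y hy]
  · intro lam hlam
    rw [← integral_congr_ae (Eventually.of_forall (hpt lam hlam)),
      ← integral_indicator (hV lam).measurableSet, Measure.volume_eq_prod,
      integral_prod_symm _ (h_int lam)]
  · intro lam hlam
    exact (h_int lam).integral_prod_right.aestronglyMeasurable.congr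
      (Eventually.of_forall (hpt lam hlam))

end Slices

/-- Fubini-type identity for mixed one-sided derivatives of `∬ f(x)g(y)` over
`K + Σ λᵢ(Aᵢ×0) + Σ θⱼ(0×Bⱼ)`: they can be computed by first integrating over slices. -/
theorem mixed_derivative_fubini_over_slices {m q : ℕ} (hm : 1 ≤ m) (hq : 1 ≤ q)
    (f : Euc m → ℂ) (g : Euc q → ℂ) (hf : ContDiff ℝ ∞ f) (hg : ContDiff ℝ ∞ g)
    (k p : ℕ) (A : Fin k → ConvexBody (Euc m)) (B : Fin p → ConvexBody (Euc q))
    (K : ConvexBody (Euc m × Euc q)) :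
    mixedPartialAtZero (fun lam : Fin k → ℝ =>
      mixedPartialAtZero (fun th : Fin p → ℝ =>
        ∫ z in ((K : Set (Euc m × Euc q))
            + ∑ i, lam i • ((A i : Set (Euc m)) ×ˢ ({0} : Set (Euc q)))
            + ∑ j, th j • (({0} : Set (Euc m)) ×ˢ (B j : Set (Euc q)))),
          f z.1 * g z.2))
    = mixedPartialAtZero (fun th : Fin p → ℝ =>
        ∫ y, g y * sliceIntegral f A K B th y) := by
  let X : Fin k ⊕ Fin p → Set (Euc m × Euc q) := Sum.elim
    (fun i => (A i : Set (Euc m)) ×ˢ ({0} : Set (Euc q)))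
    (fun j => ({0} : Set (Euc m)) ×ˢ (B j : Set (Euc q)))
  let F : Euc m × Euc q → ℂ := fun z => f z.1 * g z.2
  have hF : ContDiff ℝ ∞ F := (hf.comp contDiff_fst).mul (hg.comp contDiff_snd)
  have hX : ∀ c, IsCompact (X c) ∧ (X c).Nonempty ∧ Convex ℝ (X c) := by
    rintro (i | j)
    · exact ⟨(A i).isCompact.prod isCompact_singleton, (A i).nonempty.prod (singleton_nonempty 0),
        (A i).convex.prod (convex_singleton 0)⟩
    · exact ⟨isCompact_singleton.prod (B j).isCompact, (singleton_nonempty 0).prod (B j).nonempty,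
        (convex_singleton 0).prod (B j).convex⟩
  have hXK : ∀ o : Option (Fin k ⊕ Fin p), IsCompact (o.elim (K : Set (Euc m × Euc q)) X) ∧
      (o.elim (K : Set (Euc m × Euc q)) X).Nonempty ∧
      Convex ℝ (o.elim (K : Set (Euc m × Euc q)) X) := by
    rintro (_ | c)
    exacts [⟨K.isCompact, K.nonempty, K.convex⟩, hX c]
  have : (volume : Measure (Euc m × Euc q)).IsAddHaarMeasure := by
    rw [Measure.volume_eq_prod]
    infer_instance
  obtain ⟨ν, hν⟩ := exists_isRepresenting le_rfl (volume : Measure (Euc m × Euc q))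
    (fun o => (hXK o).1) (fun o => (hXK o).2.1) (fun o => (hXK o).2.2)
  obtain ⟨M, R, hνb⟩ : ∃ M R, BoundedMeasures M R ν := hν.exists_boundedMeasures fun o => (hXK o).1
  let Ψ := minkowskiIntegrand (n := Module.finrank ℝ (Euc m × Euc q))
    (ι := Option (Fin k ⊕ Fin p)) F
  have hΨ : ∀ j, ContDiff ℝ ∞ (Ψ j) := contDiff_minkowskiIntegrand hF
  let u : Option (Fin k ⊕ Fin p) → ℝ := Pi.single none 1
  let v : Fin k → Option (Fin k ⊕ Fin p) → ℝ := fun i => Pi.single (some (Sum.inl i)) 1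
  let w : Fin p → Option (Fin k ⊕ Fin p) → ℝ := fun j => Pi.single (some (Sum.inr j)) 1
  have hI : ∀ (lam : Fin k → ℝ) (th : Fin p → ℝ), 0 ≤ lam → 0 ≤ th →
      ∫ z in ((K : Set (Euc m × Euc q))
        + ∑ i, lam i • ((A i : Set (Euc m)) ×ˢ ({0} : Set (Euc q)))
        + ∑ j, th j • (({0} : Set (Euc m)) ×ˢ (B j : Set (Euc q)))), F z =
      paramIntegral ν Ψ (u + ∑ i, lam i • v i + ∑ j, th j • w j) := by
    intro lam th hlam hth
    have h1 := single_none_add_sum (Sum.elim lam th)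
    have h2 := sum_smul_option (Sum.elim lam th) (K : Set (Euc m × Euc q)) X
    rw [Fintype.sum_sum_type, ← add_assoc] at h1 h2
    have h3 := hν.setIntegral_eq F hF.continuous (fun o => o.elim 1 (Sum.elim lam th)) (by
      rintro (_ | i | j)
      exacts [zero_le_one, hlam i, hth j])
    rw [h2, ← h1] at h3
    exact h3
  have hL : mixedPartialAtZero (fun lam : Fin k → ℝ => mixedPartialAtZero (fun th : Fin p → ℝ =>
      ∫ z in ((K : Set (Euc m × Euc q))
        + ∑ i, lam i • ((A i : Set (Euc m)) ×ˢ ({0} : Set (Euc q)))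
        + ∑ j, th j • (({0} : Set (Euc m)) ×ˢ (B j : Set (Euc q)))), F z)) =
      paramIntegral ν (partialList v (List.finRange k) (partialList w (List.finRange p) Ψ)) u :=
    mixedPartialAtZero_paramIntegral hνb u v (contDiff_partialList w _ hΨ) fun lam hlam =>
      mixedPartialAtZero_paramIntegral hνb _ w hΨ fun th hth => hI lam th hlam hth
  rw [hL, partialList_comm v w _ _ hΨ]
  refine (mixedPartialAtZero_paramIntegral hνb u w (contDiff_partialList v _ hΨ)
    fun th hth => ?_).symm
  have hR : mixedPartialAtZero (fun lam : Fin k → ℝ => ∫ z in ((K : Set (Euc m × Euc q))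
        + ∑ j, th j • (({0} : Set (Euc m)) ×ˢ (B j : Set (Euc q)))
        + ∑ i, lam i • ((A i : Set (Euc m)) ×ˢ ({0} : Set (Euc q)))), F z) =
      paramIntegral ν (partialList v (List.finRange k) Ψ) (u + ∑ j, th j • w j) :=
    mixedPartialAtZero_paramIntegral hνb _ v hΨ fun lam hlam => by
      rw [add_right_comm, hI lam th hlam hth, add_right_comm]
  rw [← hR]
  exact (mixedPartialAtZero_setIntegral_eq_integral_slices hf hg.continuous
    (fun i => (A i).isCompact) (fun i => (A i).nonempty) (fun i => (A i).convex)
    (K.isCompact.add (isCompact_sum_smul (fun j => (hX (Sum.inr j)).1) th))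
    (K.convex.add (convex_sum_smul (fun j => (hX (Sum.inr j)).2.2) th))).symm
end
end
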